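/- arXiv:1807.00600 — 6 statements merged into one kernel-verified Lean document; each statement's English description precedes it below -/
import Mathlib

section
/- Every gammoid is orientable: for every digraph D = (V,A) and every pair of subsets T, E ⊆ V there exists a family 𝒞 of signed subsets of E satisfying the signed circuit axioms of an oriented matroid such that the family of supports {X_± : X ∈ 𝒞} is exactly the family of circuits of the gammoid Γ(D,T,E). -/
/-- A walk in the digraph with arc set `A`: a nonempty list of vertices,
each consecutive pair of which is an arc. -/
def IsWalk {V : Type*} (A : Set (V × V)) (p : List V) : Prop :=
  p ≠ [] ∧ p.Chain' (fun u v => (u, v) ∈ A)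

/-- A path: a walk with pairwise distinct vertices. -/
def IsPath {V : Type*} (A : Set (V × V)) (p : List V) : Prop :=
  IsWalk A p ∧ p.Nodup

/-- The set of arcs traversed by a walk. -/
def pathArcs {V : Type*} (p : List V) : Set (V × V) :=
  {a | a ∈ p.zip p.tail}

/-- A cycle: a walk `c₁…c_n` with `n > 1`, `c₁ = c_n`, and `c₁…c_{n-1}` a path. -/
def IsCycle {V : Type*} (A : Set (V × V)) (p : List V) : Prop :=
  IsWalk A p ∧ 1 < p.length ∧ p.head? = p.getLast? ∧ IsPath A p.dropLast

/-- A routing from `X` to `Y`: a set of pairwise vertex-disjoint paths such that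
every `x ∈ X` is the first vertex of some path and every path ends in `Y`. -/
def IsRouting {V : Type*} (A : Set (V × V)) (R : Set (List V)) (X Y : Set V) : Prop :=
  (∀ p ∈ R, IsPath A p) ∧
  (∀ x ∈ X, ∃ p ∈ R, p.head? = some x) ∧
  (∀ p ∈ R, ∃ y ∈ Y, p.getLast? = some y) ∧
  (∀ p ∈ R, ∀ q ∈ R, p = q ∨ ∀ v, v ∈ p → v ∉ q)

/-- There is a routing from `X` to `Y` in the digraph with arcs `A`. -/
def HasRouting {V : Type*} (A : Set (V × V)) (X Y : Set V) : Prop :=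
  ∃ R, IsRouting A R X Y

/-- A linking from `X` onto `Y`: a routing whose set of path endpoints is exactly `Y`. -/
def IsLinking {V : Type*} (A : Set (V × V)) (R : Set (List V)) (X Y : Set V) : Prop :=
  IsRouting A R X Y ∧ {y | ∃ p ∈ R, p.getLast? = some y} = Y

/-- Independence in the gammoid `Γ(D,T,E)`. -/
def GammoidIndep {V : Type*} (A : Set (V × V)) (T E : Set V) (X : Set V) : Prop :=
  X ⊆ E ∧ HasRouting A X T

/-- Circuits of the gammoid `Γ(D,T,E)`: minimal dependent subsets of `E`. -/
def GammoidCircuit {V : Type*} (A : Set (V × V)) (T E : Set V) (C : Set V) : Prop :=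
  C ⊆ E ∧ ¬HasRouting A C T ∧ ∀ C', C' ⊂ C → HasRouting A C' T

/-- Independence in the contraction `M/C` of a matroid given by its independence
predicate: `X` is independent iff `X ∪ I` is independent for some maximal
independent subset `I` of `C`. -/
def ContractIndep {α : Type*} (Indep : Set α → Prop) (C : Set α) (X : Set α) : Prop :=
  ∃ I, I ⊆ C ∧ Indep I ∧ (∀ J, I ⊆ J → J ⊆ C → Indep J → J = I) ∧ Indep (X ∪ I)

/-- An indeterminate weighting: an injective map on arcs whose values cannot be expressed
as integer polynomial expressions (`a₀ + a₁·x₁₁⋯x₁ₙ + …`) in the remaining values. -/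
def IsIndetWeighting {V : Type*} (A : Set (V × V)) (w : V × V → ℝ) : Prop :=
  Set.InjOn w A ∧ ∀ a ∈ A, w a ∉ Subring.closure (w '' A \ {w a})

/-- The product of the weights of the arcs traversed by a walk. -/
def pathProd {V : Type*} (w : V × V → ℝ) (p : List V) : ℝ :=
  ((p.zip p.tail).map w).prod

/-- The path matrix: `μ(u,v)` is the sum over all paths from `u` to `v`
of the product of the arc weights. -/
noncomputable def pathMatrix {V : Type*} (A : Set (V × V)) (w : V × V → ℝ) (u v : V) : ℝ :=
  ∑ᶠ p ∈ {p : List V | IsPath A p ∧ p.head? = some u ∧ p.getLast? = some v}, pathProd w p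

/-- `r` is a linear order on the elements of `A`. -/
def IsLinearOrderOn {β : Type*} (A : Set β) (r : β → β → Prop) : Prop :=
  (∀ a ∈ A, r a a) ∧ (∀ a ∈ A, ∀ b ∈ A, r a b → r b a → a = b) ∧
  (∀ a ∈ A, ∀ b ∈ A, ∀ c ∈ A, r a b → r b c → r a c) ∧
  (∀ a ∈ A, ∀ b ∈ A, r a b ∨ r b a)

/-- The set of arcs traversed by a routing. -/
def routingArcs {V : Type*} (R : Set (List V)) : Set (V × V) :=
  ⋃ p ∈ R, pathArcs p

/-- The `(σ,≪)`-induced routing order: `Q ≪≪ R` iff the `≪`-maximal element of the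
symmetric difference `Q_A △ R_A` lies in `R_A`. -/
def RoutingLT {V : Type*} (r : V × V → V × V → Prop) (Q R : Set (List V)) : Prop :=
  ∃ a ∈ routingArcs R, a ∈ symmDiff (routingArcs Q) (routingArcs R) ∧
    ∀ b ∈ symmDiff (routingArcs Q) (routingArcs R), r b a

/-- `R` is the `≪≪`-maximal routing from `X` to `Y`. -/
def IsMaxRouting {V : Type*} (r : V × V → V × V → Prop) (A : Set (V × V))
    (R : Set (List V)) (X Y : Set V) : Prop :=
  IsRouting A R X Y ∧ ∀ Q, IsRouting A Q X Y → Q ≠ R → RoutingLT r Q R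

/-- A `(σ,≪)`-weighting: an indeterminate weighting with `|w(a)| ≥ 1`,
`sgn(w(a)) = σ(a)`, and `Σ_{L ⊆ {x ≪ a, x ≠ a}} Π_{x∈L} |w(x)| < |w(a)|` for all arcs. -/
def IsHeavyWeighting {V : Type*} (A : Set (V × V)) (σ : V × V → ℝ)
    (r : V × V → V × V → Prop) (w : V × V → ℝ) : Prop :=
  IsIndetWeighting A w ∧ ∀ a ∈ A,
    1 ≤ |w a| ∧ Real.sign (w a) = σ a ∧
    (∑ᶠ L ∈ {L : Set (V × V) | L ⊆ {x ∈ A | r x a ∧ x ≠ a}}, ∏ᶠ x ∈ L, |w x|) < |w a|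

/-- The arc set of the lifting `D^{(c)}_{(x,t)}` of a cycle `c = u v …` in `D`. -/
def liftArcs {V : Type*} (A : Set (V × V)) (u v x t : V) : Set (V × V) :=
  (A \ {(u, v)}) ∪ {(u, t), (x, v), (x, t)}

/-- A routing of `X` into `T` amounts to a system of distinct successors outside `X` for the
vertices outside `T`, where the successor of a vertex is itself or one of its out-neighbours. -/
theorem successor_of_hasRouting {V : Type*} {A : Set (V × V)} {X T : Set V}
    (h : HasRouting A X T) :
    ∃ f : V → V, (∀ u ∉ T, (u = f u ∨ (u, f u) ∈ A) ∧ f u ∉ X) ∧ Set.InjOn f Tᶜ := by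
  obtain ⟨R, hpath, hX, hT, hdisj⟩ := h
  have eq_of_mem : ∀ p ∈ R, ∀ q ∈ R, ∀ v, v ∈ p → v ∈ q → p = q := fun p hp q hq v hvp hvq =>
    (hdisj p hp q hq).resolve_right fun h => h v hvp hvq
  have hnext : ∀ u, ∃ v, u ∉ T →
      (∃ p ∈ R, ∃ s t, p = s ++ u :: v :: t) ∨ (u = v ∧ ∀ p ∈ R, u ∉ p) := by
    intro u
    by_cases hu : ∃ p ∈ R, u ∈ p
    · obtain ⟨p, hp, hup⟩ := hu
      obtain ⟨s, t, rfl⟩ := List.append_of_mem hup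
      cases t with
      | nil =>
        obtain ⟨y, hy, hlast⟩ := hT _ hp
        simp only [List.getLast?_append, List.getLast?_singleton, Option.some_or,
          Option.some.injEq] at hlast
        exact ⟨u, fun h => absurd (hlast ▸ hy) h⟩
      | cons v t => exact ⟨v, fun _ => .inl ⟨_, hp, s, t, rfl⟩⟩
    · push Not at hu
      exact ⟨u, fun _ => .inr ⟨rfl, hu⟩⟩
  choose f hf using hnext
  refine ⟨f, fun u hu => ⟨?_, fun hfX => ?_⟩, fun u hu v hv huv => ?_⟩
  · rcases hf u hu with ⟨p, hp, s, t, rfl⟩ | ⟨h, -⟩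
    · have : List.IsChain _ _ := (hpath _ hp).1.2
      simp only [List.isChain_append, List.isChain_cons_cons] at this
      exact .inr this.2.1.1
    · exact .inl h
  · obtain ⟨q, hq, hhead⟩ := hX _ hfX
    have hmem : f u ∈ q := List.mem_of_head? hhead
    rcases hf u hu with ⟨p, hp, s, t, hps⟩ | ⟨h, hnot⟩
    · obtain rfl := eq_of_mem p hp q hq (f u) (by simp [hps]) hmem
      have hnd := (hpath _ hp).2
      rw [hps] at hhead hnd
      cases s <;> simp at hhead hnd <;> grind
    · exact hnot q hq (h.symm ▸ hmem)
  · rcases hf u hu with ⟨p, hp, s, t, hps⟩ | ⟨h, hnot⟩ <;>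
      rcases hf v hv with ⟨q, hq, s', t', hqs⟩ | ⟨h', hnot'⟩
    · obtain rfl := eq_of_mem p hp q hq (f u) (by simp [hps]) (by simp [hqs, huv])
      have hnd := (hpath _ hp).2
      have hnd' := hnd
      rw [hps] at hnd
      rw [hqs] at hnd'
      rw [hps, ← huv] at hqs
      have h1 : (s ++ [u]) ++ f u :: t = (s' ++ [v]) ++ f u :: t' := by simpa using hqs
      rw [List.append_cons_inj_of_notMem] at h1
      · simpa using (List.append_inj' h1.1 rfl).2
      · simp [List.nodup_append] at hnd' hnd ⊢
        grind
      · simp [List.nodup_append] at hnd' hnd ⊢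
        grind
    · exact absurd (by rw [h', ← huv, hps]; simp) (hnot' p hp)
    · exact absurd (by rw [h, huv, hqs]; simp) (hnot q hq)
    · rw [h, h', huv]

theorem iterate_inj_of_injOn_compl {V : Type*} {X T : Set V} {f : V → V}
    (hfX : ∀ u ∉ T, f u ∉ X) (hinj : Set.InjOn f Tᶜ) {x y : V} (hx : x ∈ X) (hy : y ∈ X) :
    ∀ i j : ℕ, (∀ k < i, f^[k] x ∉ T) → (∀ k < j, f^[k] y ∉ T) → f^[i] x = f^[j] y →
      x = y ∧ i = j
  | 0, 0, _, _, h => ⟨h, rfl⟩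
  | 0, j + 1, _, hj, h => by
    rw [Function.iterate_succ_apply'] at h
    exact absurd (h ▸ hx) (hfX _ (hj j j.lt_succ_self))
  | i + 1, 0, hi, _, h => by
    rw [Function.iterate_succ_apply'] at h
    exact absurd (h ▸ hy) (hfX _ (hi i i.lt_succ_self))
  | i + 1, j + 1, hi, hj, h => by
    rw [Function.iterate_succ_apply', Function.iterate_succ_apply'] at h
    have := iterate_inj_of_injOn_compl hfX hinj hx hy i j
      (fun k hk => hi k (hk.trans i.lt_succ_self)) (fun k hk => hj k (hk.trans j.lt_succ_self))
      (hinj (hi i i.lt_succ_self) (hj j j.lt_succ_self) h)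
    exact ⟨this.1, congrArg _ this.2⟩

theorem hasRouting_of_successor {V : Type*} [Finite V] {A : Set (V × V)} {X T : Set V}
    {f : V → V} (hf : ∀ u ∉ T, u = f u ∨ (u, f u) ∈ A) (hfX : ∀ u ∉ T, f u ∉ X)
    (hinj : Set.InjOn f Tᶜ) : HasRouting A X T := by
  classical
  have hreach : ∀ x ∈ X, ∃ n, f^[n] x ∈ T := by
    intro x hx
    by_contra! h
    exact not_injective_infinite_finite (fun n => f^[n] x) fun i j hij =>
      (iterate_inj_of_injOn_compl hfX hinj hx hx i j (fun k _ => h k) (fun k _ => h k) hij).2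
  have hn : ∀ x, ∃ n, x ∈ X → f^[n] x ∈ T ∧ ∀ k < n, f^[k] x ∉ T := by
    intro x
    by_cases hx : x ∈ X
    · exact ⟨Nat.find (hreach x hx), fun _ => ⟨Nat.find_spec (hreach x hx),
        fun k hk => Nat.find_min (hreach x hx) hk⟩⟩
    · exact ⟨0, fun h => absurd h hx⟩
  choose n hn using hn
  have hiter : ∀ x ∈ X, ∀ y ∈ X, ∀ i < n x + 1, ∀ j < n y + 1, f^[i] x = f^[j] y →
      x = y ∧ i = j := fun x hx y hy i hi j hj h =>
    iterate_inj_of_injOn_compl hfX hinj hx hy i j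
      (fun k hk => (hn x hx).2 k (by omega)) (fun k hk => (hn y hy).2 k (by omega)) h
  let p : V → List V := fun x => (List.range (n x + 1)).map fun i => f^[i] x
  refine ⟨p '' X, ?_, fun x hx => ⟨p x, ⟨x, hx, rfl⟩, by simp [p]⟩, ?_, ?_⟩
  · rintro _ ⟨x, hx, rfl⟩
    refine ⟨⟨by simp [p], ?_⟩, ?_⟩
    · refine List.isChain_iff_getElem.2 fun i hi => ?_
      simp only [p, List.length_map, List.length_range] at hi
      simp only [p, List.getElem_map, List.getElem_range]
      rw [Function.iterate_succ_apply']
      refine (hf _ ((hn x hx).2 i (by omega))).resolve_left fun h => ?_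
      rw [← Function.iterate_succ_apply' f] at h
      have := (hiter x hx x hx i (by omega) (i + 1) (by omega) h).2
      omega
    · refine List.Nodup.map_on (fun i hi j hj h => ?_) List.nodup_range
      exact (hiter x hx x hx i (by simpa using hi) j (by simpa using hj) h).2
  · rintro _ ⟨x, hx, rfl⟩
    exact ⟨_, (hn x hx).1, by simp [p, List.range_succ]⟩
  · rintro _ ⟨x, hx, rfl⟩ _ ⟨y, hy, rfl⟩
    refine or_iff_not_imp_right.2 fun h => ?_
    push Not at h
    obtain ⟨v, hvx, hvy⟩ := h
    simp only [p, List.mem_map, List.mem_range] at hvx hvy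
    obtain ⟨i, hi, rfl⟩ := hvx
    obtain ⟨j, hj, h⟩ := hvy
    rw [(hiter x hx y hy i hi j hj h.symm).1]

theorem exists_matrix_det_submatrix_ne_zero {m V : Type*} [Fintype m] [DecidableEq m] [Fintype V]
    (r : m → V → Prop) :
    ∃ M : Matrix m V ℝ, (∀ u v, M u v ≠ 0 → r u v) ∧
      ∀ f : m → V, f.Injective → (∀ u, r u (f u)) → (M.submatrix id f).det ≠ 0 := by
  classical
  let N : Matrix m V (MvPolynomial (m × V) ℝ) :=
    .of fun u v => if r u v then MvPolynomial.X (u, v) else 0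
  let F : Finset (m → V) := {f | f.Injective ∧ ∀ u, r u (f u)}
  have heval : ∀ (x : m × V → ℝ) (f : m → V),
      MvPolynomial.eval x (N.submatrix id f).det =
        Matrix.det (.of fun u u' => if r u (f u') then x (u, f u') else 0) := by
    intro x f
    rw [RingHom.map_det]
    congr 1
    ext u u'
    simp only [N, RingHom.mapMatrix_apply, Matrix.map_apply, Matrix.submatrix_apply,
      Matrix.of_apply, id]
    split_ifs <;> simp
  have hP : ∏ f ∈ F, (N.submatrix id f).det ≠ 0 := by
    refine Finset.prod_ne_zero_iff.2 fun f hf h => ?_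
    obtain ⟨hinj, hr⟩ := (Finset.mem_filter.1 hf).2
    have := heval (fun a => if a.2 = f a.1 then 1 else 0) f
    rw [h, map_zero] at this
    have hone : (Matrix.of fun u u' => if r u (f u') then
        (if f u' = f u then (1 : ℝ) else 0) else 0) = (1 : Matrix m m ℝ) := by
      ext u u'
      by_cases huu : u = u'
      · subst huu
        simp [hr]
      · simp [huu, hinj.eq_iff, Ne.symm huu]
    simp only [hone, Matrix.det_one] at this
    exact zero_ne_one this
  obtain ⟨x, hx⟩ : ∃ x, MvPolynomial.eval x (∏ f ∈ F, (N.submatrix id f).det) ≠ 0 := by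
    by_contra! h
    exact hP (MvPolynomial.funext fun x => by rw [h x, map_zero])
  refine ⟨.of fun u v => if r u v then x (u, v) else 0, fun u v h => ?_, fun f hinj hr => ?_⟩
  · by_contra hr
    simp [hr] at h
  · rw [map_prod, Finset.prod_ne_zero_iff] at hx
    have := hx f (by simp [F, hinj, hr])
    rwa [heval] at this

theorem exists_injective_of_vecMul_ne_zero {m V : Type*} [Fintype m] [Fintype V]
    {M : Matrix m V ℝ} {X : Set V} (hM : ∀ y, (∀ v ∉ X, Matrix.vecMul y M v = 0) → y = 0) :
    ∃ f : m → V, f.Injective ∧ ∀ u, M u (f u) ≠ 0 ∧ f u ∉ X := by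
  classical
  let t : m → Finset V := fun u => {v | M u v ≠ 0 ∧ v ∉ X}
  obtain ⟨f, hinj, hf⟩ := (Finset.all_card_le_biUnion_card_iff_exists_injective t).1 fun s => by
    let L := (M.submatrix ((↑) : s → m) ((↑) : s.biUnion t → V)).vecMulLinear
    have hL : Function.Injective L := by
      refine (injective_iff_map_eq_zero L).2 fun y hy => ?_
      have hsum : ∀ v, Matrix.vecMul (fun u => if h : u ∈ s then y ⟨u, h⟩ else 0) M v =
          ∑ u : s, y u * M u v := by
        intro v
        simp only [Matrix.vecMul, dotProduct]
        rw [← Finset.sum_subset s.subset_univ (fun u _ hu => by simp [hu]), ← Finset.sum_coe_sort]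
        simp
      have hzero := hM (fun u => if h : u ∈ s then y ⟨u, h⟩ else 0) fun v hv => by
        rw [hsum]
        by_cases hvt : v ∈ s.biUnion t
        · exact congrFun hy ⟨v, hvt⟩
        · refine Finset.sum_eq_zero fun u _ => ?_
          simp only [Finset.mem_biUnion, t, Finset.mem_filter, not_exists] at hvt
          have : M u v = 0 := by
            by_contra h
            exact hvt u ⟨u.2, Finset.mem_univ _, h, hv⟩
          rw [this, mul_zero]
      ext u
      simpa using congrFun hzero u
    simpa only [Module.finrank_fintype_fun_eq_card, Fintype.card_coe] using
      LinearMap.finrank_le_finrank_of_injective hL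
  exact ⟨f, hinj, fun u => by simpa [t] using hf u⟩

/-- The dual of the linear representation of a strict gammoid: linking into `T` is governed by
the supports of the vectors of a subspace. -/
theorem exists_submodule_hasRouting_iff {V : Type*} [Fintype V] (A : Set (V × V)) (T : Set V) :
    ∃ W : Submodule ℝ (V → ℝ), ∀ X,
      HasRouting A X T ↔ ∀ w ∈ W, Function.support w ⊆ X → w = 0 := by
  classical
  obtain ⟨M, hMA, hdet⟩ := exists_matrix_det_submatrix_ne_zero
    fun (u : {u // u ∉ T}) v => u.1 = v ∨ (u.1, v) ∈ A
  have hzero : ∀ f : {u // u ∉ T} → V, f.Injective → (∀ u, u.1 = f u ∨ (u.1, f u) ∈ A) →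
      ∀ y, (∀ u, Matrix.vecMul y M (f u) = 0) → y = 0 := fun f hinj hf y hy =>
    Matrix.eq_zero_of_vecMul_eq_zero (hdet f hinj hf) (funext hy)
  refine ⟨M.vecMulLinear.range, fun X => ⟨fun h => ?_, fun h => ?_⟩⟩
  · obtain ⟨f, hf, hinj⟩ := successor_of_hasRouting h
    rintro _ ⟨y, rfl⟩ hy
    have := hzero (fun u => f u) (fun u v huv => Subtype.ext (hinj u.2 v.2 huv))
      (fun u => (hf u u.2).1) y fun u => by
        by_contra hne
        exact (hf u u.2).2 (hy hne)
    rw [this, map_zero]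
  · obtain ⟨f, hinj, hf⟩ := exists_injective_of_vecMul_ne_zero (M := M) (X := X) fun y hy => by
      have := h _ ⟨y, rfl⟩ fun v hv => by
        by_contra hvX
        exact hv (hy v hvX)
      exact hzero _ Subtype.val_injective (fun _ => .inl rfl) y fun u => congrFun this u
    refine hasRouting_of_successor (f := fun u => if hu : u ∉ T then f ⟨u, hu⟩ else u)
      (fun u hu => ?_) (fun u hu => ?_) (fun u hu v hv huv => ?_)
    · simpa only [hu, not_false_eq_true, dite_true] using hMA _ _ (hf ⟨u, hu⟩).1
    · simpa only [hu, not_false_eq_true, dite_true] using (hf ⟨u, hu⟩).2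
    · simp only [show u ∉ T from hu, show v ∉ T from hv, not_false_eq_true, dite_true] at huv
      exact congrArg Subtype.val (hinj huv)

/-- A nonzero vector of minimal support in a subspace. -/
def IsElementary {V : Type*} (W : Submodule ℝ (V → ℝ)) (w : V → ℝ) : Prop :=
  w ∈ W ∧ w ≠ 0 ∧ ∀ z ∈ W, z ≠ 0 → Function.support z ⊆ Function.support w →
    Function.support w ⊆ Function.support z

theorem IsElementary.neg {V : Type*} {W : Submodule ℝ (V → ℝ)} {w : V → ℝ}
    (h : IsElementary W w) : IsElementary W (-w) :=
  ⟨W.neg_mem h.1, neg_ne_zero.2 h.2.1, by simpa only [Function.support_neg] using h.2.2⟩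

theorem IsElementary.eq_smul {V : Type*} {W : Submodule ℝ (V → ℝ)} {w z : V → ℝ}
    (hw : IsElementary W w) (hz : IsElementary W z)
    (h : Function.support w ⊆ Function.support z) : ∃ c : ℝ, c ≠ 0 ∧ w = c • z := by
  obtain ⟨e, he⟩ := Function.ne_iff.1 hz.2.1
  have hwe : w e ≠ 0 := hz.2.2 w hw.1 hw.2.1 h he
  have he : z e ≠ 0 := he
  refine ⟨w e / z e, div_ne_zero hwe he, ?_⟩
  by_contra hne
  refine hz.2.2 (w - (w e / z e) • z) (W.sub_mem hw.1 (W.smul_mem _ hz.1)) (sub_ne_zero.2 hne)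
    (fun f hf hzf => hf ?_) he ?_
  · have hwf : w f = 0 := by
      by_contra hwf
      exact h hwf hzf
    simp [hzf, hwf]
  · simp [he]

theorem exists_conformal_reduction {V : Type*} [Fintype V] {z w : V → ℝ}
    (hsupp : Function.support w ⊆ Function.support z) {f : V} (hf : 0 < w f * z f) :
    ∃ c : ℝ, (∃ e, z e ≠ 0 ∧ z e - c * w e = 0) ∧
      ∀ e, (0 < z e - c * w e → 0 < z e) ∧ (z e - c * w e < 0 → z e < 0) := by
  classical
  obtain ⟨e, he, hmin⟩ := Finset.exists_min_image ({e | 0 < w e * z e} : Finset V)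
    (fun e => z e / w e) ⟨f, by simpa using hf⟩
  simp only [Finset.mem_filter, Finset.mem_univ, true_and] at he hmin
  have hwe : w e ≠ 0 := left_ne_zero_of_mul he.ne'
  have hc : 0 < z e / w e := by
    rw [← mul_div_mul_left _ _ hwe]
    exact div_pos he (mul_self_pos.2 hwe)
  refine ⟨z e / w e, ⟨e, right_ne_zero_of_mul he.ne', by field_simp; ring⟩, fun g => ⟨?_, ?_⟩⟩
  · intro hg
    by_contra! hzg
    have hwg : w g < 0 := by
      by_contra! hwg
      nlinarith [mul_nonneg hc.le hwg]
    have hzg' : z g < 0 := lt_of_le_of_ne hzg (hsupp hwg.ne)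
    have := (le_div_iff_of_neg hwg).1 (hmin g (mul_pos_of_neg_of_neg hwg hzg'))
    linarith
  · intro hg
    by_contra! hzg
    have hwg : 0 < w g := by
      by_contra! hwg
      nlinarith [mul_nonneg hc.le (neg_nonneg.2 hwg)]
    have hzg' : 0 < z g := lt_of_le_of_ne hzg (Ne.symm (hsupp hwg.ne'))
    have := (le_div_iff₀ hwg).1 (hmin g (mul_pos hwg hzg'))
    linarith

theorem exists_isElementary_conformal {V : Type*} [Fintype V] {W : Submodule ℝ (V → ℝ)}
    {z : V → ℝ} (hz : z ∈ W) (hz0 : z ≠ 0) :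
    ∃ w, IsElementary W w ∧ ∀ e, (0 < w e → 0 < z e) ∧ (w e < 0 → z e < 0) := by
  induction hn : (Function.support z).ncard using Nat.strong_induction_on generalizing z with
  | _ n ih =>
    subst hn
    by_cases hel : IsElementary W z
    · exact ⟨z, hel, fun _ => ⟨id, id⟩⟩
    obtain ⟨w, hw, hw0, hwz, hzw⟩ : ∃ w ∈ W, w ≠ 0 ∧ Function.support w ⊆ Function.support z ∧
        ¬Function.support z ⊆ Function.support w := by
      simpa [IsElementary, hz, hz0] using hel
    obtain ⟨g, hgz, hgw⟩ := Set.not_subset.1 hzw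
    obtain ⟨f, hf⟩ := Function.ne_iff.1 hw0
    obtain ⟨w, hw, hwz, hgw, f, hf⟩ : ∃ w ∈ W, Function.support w ⊆ Function.support z ∧
        w g = 0 ∧ ∃ f, 0 < w f * z f := by
      rcases lt_or_gt_of_ne (mul_ne_zero hf (hwz hf)) with h | h
      · exact ⟨-w, W.neg_mem hw, by rwa [Function.support_neg],
          by simpa using hgw, f, by simpa using h⟩
      · exact ⟨w, hw, hwz, by simpa using hgw, f, h⟩
    obtain ⟨c, ⟨e, hze, hce⟩, hc⟩ := exists_conformal_reduction hwz hf
    have hlt : (Function.support (z - c • w)).ncard < (Function.support z).ncard := by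
      refine Set.ncard_lt_ncard ⟨fun e he => ?_, fun h => h hze hce⟩ (Set.toFinite _)
      rcases lt_or_gt_of_ne (show z e - c * w e ≠ 0 from he) with h | h
      · exact ((hc e).2 h).ne
      · exact ((hc e).1 h).ne'
    obtain ⟨x, hx, hxz⟩ := ih _ hlt (W.sub_mem hz (W.smul_mem c hw))
      (Function.ne_iff.2 ⟨g, by simpa [hgw] using hgz⟩) rfl
    exact ⟨x, hx, fun e => ⟨fun h => (hc e).1 ((hxz e).1 h), fun h => (hc e).2 ((hxz e).2 h)⟩⟩

/-- The sign vector of a real vector. -/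
noncomputable def signVec {V : Type*} (w : V → ℝ) (e : V) : ℤ :=
  SignType.sign (w e)

theorem signVec_eq_one {V : Type*} {w : V → ℝ} {e : V} : signVec w e = 1 ↔ 0 < w e := by
  rcases lt_trichotomy (w e) 0 with h | h | h <;> simp [signVec, h, h.le]

theorem signVec_eq_neg_one {V : Type*} {w : V → ℝ} {e : V} : signVec w e = -1 ↔ w e < 0 := by
  rcases lt_trichotomy (w e) 0 with h | h | h <;> simp [signVec, h, h.le]

theorem signVec_ne_zero {V : Type*} (w : V → ℝ) :
    {e | signVec w e ≠ 0} = Function.support w := by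
  ext e
  rcases lt_trichotomy (w e) 0 with h | h | h
  · simp [signVec, h, h.ne]
  · simp [signVec, h]
  · simp [signVec, h, h.ne']

theorem signVec_neg {V : Type*} (w : V → ℝ) : signVec (-w) = fun e => -signVec w e := by
  ext e
  rcases lt_trichotomy (w e) 0 with h | h | h <;> simp [signVec, h]

theorem signVec_smul {V : Type*} {c : ℝ} (hc : c ≠ 0) (w : V → ℝ) :
    signVec (c • w) = signVec w ∨ signVec (c • w) = fun e => -signVec w e := by
  rcases lt_or_gt_of_ne hc with h | h
  · right
    ext e
    simp [signVec, sign_mul, h]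
  · left
    ext e
    simp [signVec, sign_mul, h]

theorem gammoidCircuit_iff {V : Type*} {A : Set (V × V)} {T E : Set V}
    {W : Submodule ℝ (V → ℝ)}
    (hW : ∀ X, HasRouting A X T ↔ ∀ w ∈ W, Function.support w ⊆ X → w = 0) (C : Set V) :
    GammoidCircuit A T E C ↔ C ⊆ E ∧ ∃ w, IsElementary W w ∧ C = Function.support w := by
  constructor
  · rintro ⟨hCE, hC, hmin⟩
    have hsupp : ∀ w ∈ W, w ≠ 0 → Function.support w ⊆ C → C = Function.support w := by
      intro w hw hw0 hwC
      by_contra hne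
      exact hw0 ((hW _).1 (hmin _ (hwC.ssubset_of_ne (Ne.symm hne))) w hw subset_rfl)
    rw [hW] at hC
    push Not at hC
    obtain ⟨w, hw, hwC, hw0⟩ := hC
    obtain rfl := hsupp w hw hw0 hwC
    exact ⟨hCE, w, ⟨hw, hw0, fun z hz hz0 hzw => (hsupp z hz hz0 hzw).subset⟩, rfl⟩
  · rintro ⟨hCE, w, hw, rfl⟩
    refine ⟨hCE, fun h => hw.2.1 ((hW _).1 h w hw.1 subset_rfl), fun C' hC' => ?_⟩
    refine (hW _).2 fun z hz hzC => ?_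
    by_contra hz0
    exact hC'.2 ((hw.2.2 z hz hz0 (hzC.trans hC'.1)).trans hzC)
/-- Every gammoid is orientable: there is a family of signed subsets of `E` satisfying the
signed circuit axioms of an oriented matroid whose supports are exactly the circuits of
`Γ(D,T,E)`. -/
theorem gammoid_orientable {V : Type*} [Fintype V] (A : Set (V × V)) (T E : Set V) :
    ∃ 𝒞 : Set (V → ℤ),
      (∀ X ∈ 𝒞, (∀ e, X e = -1 ∨ X e = 0 ∨ X e = 1) ∧ {e | X e ≠ 0} ⊆ E) ∧
      (fun _ => (0 : ℤ)) ∉ 𝒞 ∧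
      (∀ X ∈ 𝒞, (fun e => -X e) ∈ 𝒞) ∧
      (∀ X ∈ 𝒞, ∀ Y ∈ 𝒞, {e | X e ≠ 0} ⊆ {e | Y e ≠ 0} → X = Y ∨ X = fun e => -Y e) ∧
      (∀ X ∈ 𝒞, ∀ Y ∈ 𝒞, X ≠ (fun e => -Y e) → ∀ e, X e = 1 → Y e = -1 →
        ∃ Z ∈ 𝒞, {f | Z f = 1} ⊆ ({f | X f = 1} ∪ {f | Y f = 1}) \ {e} ∧
                 {f | Z f = -1} ⊆ ({f | X f = -1} ∪ {f | Y f = -1}) \ {e}) ∧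
      {S | ∃ X ∈ 𝒞, S = {e | X e ≠ 0}} = {C | GammoidCircuit A T E C} := by
  obtain ⟨W, hW⟩ := exists_submodule_hasRouting_iff A T
  refine ⟨{X | ∃ w, IsElementary W w ∧ Function.support w ⊆ E ∧ X = signVec w},
    ?_, ?_, ?_, ?_, ?_, ?_⟩
  · rintro _ ⟨w, -, hwE, rfl⟩
    refine ⟨fun e => ?_, by rwa [signVec_ne_zero]⟩
    rcases lt_trichotomy (w e) 0 with h | h | h <;> simp [signVec, h]
  · rintro ⟨w, hw, -, h⟩
    have := signVec_ne_zero w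
    rw [← h] at this
    exact hw.2.1 (Function.support_eq_empty_iff.1 (by simpa using this.symm))
  · rintro _ ⟨w, hw, hwE, rfl⟩
    exact ⟨-w, hw.neg, by rwa [Function.support_neg], (signVec_neg w).symm⟩
  · rintro _ ⟨w, hw, -, rfl⟩ _ ⟨z, hz, -, rfl⟩ h
    rw [signVec_ne_zero, signVec_ne_zero] at h
    obtain ⟨c, hc, rfl⟩ := hw.eq_smul hz h
    exact signVec_smul hc z
  · rintro _ ⟨w, hw, hwE, rfl⟩ _ ⟨z, hz, hzE, rfl⟩ hne e hwe hze
    rw [signVec_eq_one] at hwe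
    rw [signVec_eq_neg_one] at hze
    have hxe : ((-z e) • w + w e • z) e = 0 := by simp; ring
    have hx0 : (-z e) • w + w e • z ≠ 0 := by
      intro h
      have hwz : w = (w e / z e) • z := by
        ext f
        have hf := congrFun h f
        simp only [Pi.add_apply, Pi.smul_apply, smul_eq_mul, Pi.zero_apply] at hf ⊢
        field_simp [hze.ne]
        linarith
      have hc := signVec_smul (div_ne_zero hwe.ne' hze.ne) z
      rw [← hwz] at hc
      refine hc.elim (fun h => ?_) hne
      have := (signVec_eq_one.2 hwe).symm.trans ((congrFun h e).trans (signVec_eq_neg_one.2 hze))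
      omega
    obtain ⟨x, hx, hconf⟩ := exists_isElementary_conformal
      (W.add_mem (W.smul_mem (-z e) hw.1) (W.smul_mem (w e) hz.1)) hx0
    have hpos : ∀ f, 0 < x f → (0 < w f ∨ 0 < z f) ∧ f ≠ e := by
      intro f hf
      have h := (hconf f).1 hf
      refine ⟨?_, by rintro rfl; exact h.ne' hxe⟩
      by_contra! hle
      simp only [Pi.add_apply, Pi.smul_apply, smul_eq_mul] at h
      nlinarith [mul_nonneg_of_nonpos_of_nonpos hze.le hle.1,
        mul_nonpos_of_nonneg_of_nonpos hwe.le hle.2]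
    have hneg : ∀ f, x f < 0 → (w f < 0 ∨ z f < 0) ∧ f ≠ e := by
      intro f hf
      have h := (hconf f).2 hf
      refine ⟨?_, by rintro rfl; exact h.ne hxe⟩
      by_contra! hle
      simp only [Pi.add_apply, Pi.smul_apply, smul_eq_mul] at h
      nlinarith [mul_nonneg (neg_nonneg.2 hze.le) hle.1, mul_nonneg hwe.le hle.2]
    refine ⟨signVec x, ⟨x, hx, fun f hf => ?_, rfl⟩, fun f hf => ?_, fun f hf => ?_⟩
    · rcases lt_or_gt_of_ne (show x f ≠ 0 from hf) with h | h
      · exact (hneg f h).1.elim (fun h => hwE h.ne) fun h => hzE h.ne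
      · exact (hpos f h).1.elim (fun h => hwE h.ne') fun h => hzE h.ne'
    · simpa only [Set.mem_sdiff, Set.mem_union, Set.mem_ofPred_eq, signVec_eq_one,
        Set.mem_singleton_iff] using hpos f (signVec_eq_one.1 hf)
    · simpa only [Set.mem_sdiff, Set.mem_union, Set.mem_ofPred_eq, signVec_eq_neg_one,
        Set.mem_singleton_iff] using hneg f (signVec_eq_neg_one.1 hf)
  · ext C
    simp only [Set.mem_ofPred_eq, gammoidCircuit_iff hW]
    constructor
    · rintro ⟨_, ⟨w, hw, hwE, rfl⟩, rfl⟩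
      rw [signVec_ne_zero]
      exact ⟨hwE, w, hw, rfl⟩
    · rintro ⟨hCE, w, hw, rfl⟩
      exact ⟨_, ⟨w, hw, hCE, rfl⟩, (signVec_ne_zero w).symm⟩
end

section
/- Every gammoid is representable over the reals: for every digraph D = (V,A) and T, E ⊆ V there exist a finite set T' with |T'| equal to the rank of Γ(D,T,E) and a matrix μ ∈ ℝ^{E×T'} such that a set X ⊆ E is independent in Γ(D,T,E) if and only if the rows of μ indexed by X are linearly independent over ℝ. -/
/-- The image of a linearly independent family under a linear map is linearly independent iff
its span meets the kernel trivially. -/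
theorem LinearIndependent.map_iff_disjoint_ker {ι K M N : Type*} [Ring K] [AddCommGroup M]
    [Module K M] [AddCommGroup N] [Module K N] {v : ι → M} (hv : LinearIndependent K v)
    (f : M →ₗ[K] N) :
    LinearIndependent K (fun i => f (v i)) ↔
      Disjoint (Submodule.span K (Set.range v)) (LinearMap.ker f) := by
  refine ⟨fun h => ?_, fun h => hv.map h⟩
  rw [Submodule.disjoint_def]
  intro x hx hfx
  obtain ⟨c, rfl⟩ := Finsupp.mem_span_range_iff_exists_finsupp.1 hx
  have h0 : Finsupp.linearCombination K (fun i => f (v i)) c = 0 := by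
    rw [LinearMap.mem_ker, map_finsuppSum] at hfx
    simpa [Finsupp.linearCombination_apply] using hfx
  rw [linearIndependent_iff] at h
  simp [h c h0]

/-- The span of the coordinate vectors indexed by `X` is the kernel of the restriction of
functions to the complement of `X`. -/
theorem span_single_eq_ker_funLeft {V K : Type*} [Finite V] [DecidableEq V] [Ring K]
    (X : Set V) :
    Submodule.span K (Set.range fun x : X => (Pi.single (x : V) 1 : V → K)) =
      LinearMap.ker (LinearMap.funLeft K K (Subtype.val : (Xᶜ : Set V) → V)) := by
  cases nonempty_fintype V
  apply le_antisymm
  · rw [Submodule.span_le]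
    rintro _ ⟨x, rfl⟩
    rw [SetLike.mem_coe, LinearMap.mem_ker]
    ext w
    have hw : (w : V) ≠ x := fun h => w.2 (h ▸ x.2)
    simp [LinearMap.funLeft_apply, hw]
  · intro c hc
    rw [pi_eq_sum_univ' c]
    refine Submodule.sum_mem _ fun v _ => ?_
    by_cases hv : v ∈ X
    · exact Submodule.smul_mem _ _ (Submodule.subset_span ⟨⟨v, hv⟩, rfl⟩)
    · have h0 : c v = 0 := congrFun (LinearMap.mem_ker.1 hc) ⟨v, hv⟩
      simp [h0]

/-- Linear duality: for linearly independent rows `r`, the coordinate vectors indexed by `X` are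
independent modulo the row space iff the rows stay independent after deleting the columns `X`. -/
theorem linearIndependent_mkQ_single_iff {V K ι : Type*} [Finite V] [DecidableEq V] [Ring K]
    {r : ι → V → K} (hr : LinearIndependent K r) (X : Set V) :
    LinearIndependent K
        (fun x : X => (Submodule.span K (Set.range r)).mkQ (Pi.single (x : V) 1)) ↔
      LinearIndependent K (fun i => fun w : (Xᶜ : Set V) => r i w) := by
  have hX : LinearIndependent K (fun x : X => (Pi.single (x : V) 1 : V → K)) :=
    (Pi.linearIndependent_single_one V K).comp _ Subtype.val_injective
  have h := hr.map_iff_disjoint_ker (LinearMap.funLeft K K (Subtype.val : (Xᶜ : Set V) → V))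
  rw [hX.map_iff_disjoint_ker, Submodule.ker_mkQ, span_single_eq_ker_funLeft, disjoint_comm]
  exact h.symm

/-- A matrix with linearly independent rows has a transversal of nonzero entries covering
all rows. -/
theorem exists_injective_entry_ne_zero {I J K : Type*} [Finite J] [Field K] {M : I → J → K}
    (hM : LinearIndependent K M) : ∃ f : I → J, Function.Injective f ∧ ∀ i, M i (f i) ≠ 0 := by
  classical
  cases nonempty_fintype J
  obtain ⟨f, hf, hfM⟩ := (Finset.all_card_le_biUnion_card_iff_exists_injective
    (fun i => Finset.univ.filter fun j => M i j ≠ 0)).1 (by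
      intro s
      set N := s.biUnion fun i => Finset.univ.filter fun j => M i j ≠ 0 with hN
      have h : LinearIndependent K (fun i : s => fun j : N => M i j) := by
        have hs : LinearIndependent K (fun i : s => M i) := hM.comp _ Subtype.val_injective
        rw [Fintype.linearIndependent_iff] at hs ⊢
        intro g hg
        refine hs g (funext fun j => ?_)
        by_cases hj : j ∈ N
        · simpa using congrFun hg ⟨j, hj⟩
        · have h0 : ∀ i : s, M i j = 0 := by
            intro i
            by_contra hne
            exact hj (by simpa [hN] using ⟨i, i.2, hne⟩)
          simp [h0]
      simpa using h.fintype_card_le_finrank)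
  exact ⟨f, hf, fun i => by simpa using hfM i⟩

/-- Finitely many nonzero real polynomials have a common point of nonvanishing. -/
theorem MvPolynomial.exists_forall_eval_ne_zero {σ ι : Type*} [Finite ι]
    (p : ι → MvPolynomial σ ℝ) (hp : ∀ i, p i ≠ 0) :
    ∃ x : σ → ℝ, ∀ i, MvPolynomial.eval x (p i) ≠ 0 := by
  cases nonempty_fintype ι
  by_contra! h
  have h0 : ∏ i, p i = 0 := MvPolynomial.funext fun x => by
    obtain ⟨i, hi⟩ := h x
    rw [map_prod, map_zero]
    exact Finset.prod_eq_zero (Finset.mem_univ i) hi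
  obtain ⟨i, -, hi⟩ := Finset.prod_eq_zero_iff.1 h0
  exact hp i hi

/-- There is a real matrix supported on `r` in which every square submatrix having a transversal
inside `r` is nonsingular. -/
theorem exists_generic_matrix {V : Type*} [Finite V] (r : V → V → Prop) :
    ∃ m : V → V → ℝ, (∀ v w, m v w ≠ 0 → r v w) ∧
      ∀ (S : Set V) (f : V → V), Set.InjOn f S → (∀ v ∈ S, r v (f v)) →
        LinearIndependent ℝ (fun i : S => fun j : S => m i (f j)) := by
  classical
  cases nonempty_fintype V
  let P : {q : Set V × (V → V) // Set.InjOn q.2 q.1 ∧ ∀ v ∈ q.1, r v (q.2 v)} →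
      MvPolynomial (V × V) ℝ := fun q =>
    (Matrix.of fun i j : q.1.1 =>
      if r i (q.1.2 j) then MvPolynomial.X ((i : V), q.1.2 j) else 0).det
  have hP : ∀ q x, MvPolynomial.eval x (P q) = (Matrix.of fun i j : q.1.1 =>
      if r i (q.1.2 j) then x ((i : V), q.1.2 j) else 0).det := by
    intro q x
    rw [RingHom.map_det]
    congr 1
    ext i j
    simp only [RingHom.mapMatrix_apply, Matrix.map_apply, Matrix.of_apply]
    split_ifs <;> simp
  obtain ⟨x, hx⟩ := MvPolynomial.exists_forall_eval_ne_zero P (by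
    rintro ⟨⟨S, f⟩, hf, hr⟩ h0
    have h1 := hP ⟨⟨S, f⟩, hf, hr⟩ (fun a => if f a.1 = a.2 then 1 else 0)
    rw [h0, map_zero] at h1
    have h2 : (Matrix.of fun i j : S =>
        if r i (f j) then (if f i = f j then (1 : ℝ) else 0) else 0) = 1 := by
      ext i j
      by_cases hij : i = j
      · subst hij
        simp [hr i i.2]
      · have : f i ≠ f j := fun h => hij (Subtype.ext (hf i.2 j.2 h))
        simp [this, hij]
    rw [h2, Matrix.det_one] at h1
    exact zero_ne_one h1)
  refine ⟨fun v w => if r v w then x (v, w) else 0, fun v w h => ?_, fun S f hf hr => ?_⟩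
  · by_contra hvw
    simp [hvw] at h
  · have h := hx ⟨⟨S, f⟩, hf, hr⟩
    rw [hP] at h
    exact Matrix.linearIndependent_rows_of_det_ne_zero h

/-- A routing from `X` to `T` yields an injection from the complement of `T` to the complement
of `X` moving vertices along arcs or not at all. -/
theorem HasRouting.exists_injOn {V : Type*} {A : Set (V × V)} {X T : Set V}
    (h : HasRouting A X T) :
    ∃ f : V → V, Set.InjOn f Tᶜ ∧ ∀ v ∈ Tᶜ, f v ∉ X ∧ (v = f v ∨ (v, f v) ∈ A) := by
  obtain ⟨R, hpath, hX, hT, hdisj⟩ := h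
  have huniq : ∀ p ∈ R, ∀ q ∈ R, ∀ i j : ℕ, ∀ v, p[i]? = some v → q[j]? = some v →
      p = q ∧ i = j := by
    intro p hp q hq i j v hi hj
    have hpq : p = q := (hdisj p hp q hq).resolve_right fun hv =>
      hv v (List.mem_of_getElem? hi) (List.mem_of_getElem? hj)
    subst hpq
    exact ⟨rfl, (List.getElem?_inj (List.getElem?_eq_some_iff.1 hi).1 (hpath p hp).2).1
      (hi.trans hj.symm)⟩
  have hsucc : ∀ v, ∃ w, v ∈ Tᶜ →
      (∃ p ∈ R, ∃ i : ℕ, p[i]? = some v ∧ p[i + 1]? = some w) ∨ (w = v ∧ ∀ p ∈ R, v ∉ p) := by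
    intro v
    by_cases hv : ∃ p ∈ R, v ∈ p
    · obtain ⟨p, hp, hvp⟩ := hv
      obtain ⟨i, hi⟩ := List.mem_iff_getElem?.1 hvp
      by_cases hlt : i + 1 < p.length
      · exact ⟨p[i + 1], fun _ => .inl ⟨p, hp, i, hi, List.getElem?_eq_getElem hlt⟩⟩
      · refine ⟨v, fun hvT => absurd ?_ hvT⟩
        obtain ⟨y, hy, hlast⟩ := hT p hp
        have hlen := (List.getElem?_eq_some_iff.1 hi).1
        have : p.length - 1 = i := by omega
        rw [List.getLast?_eq_getElem?, this, hi] at hlast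
        exact Option.some.inj hlast ▸ hy
    · push Not at hv
      exact ⟨v, fun _ => .inr ⟨rfl, hv⟩⟩
  choose f hf using hsucc
  refine ⟨f, fun v hv w hw hvw => ?_, fun v hv => ⟨fun hfX => ?_, ?_⟩⟩
  · rcases hf v hv with ⟨p, hp, i, hi, hi'⟩ | ⟨hfv, hnv⟩ <;>
      rcases hf w hw with ⟨q, hq, j, hj, hj'⟩ | ⟨hfw, hnw⟩
    · obtain ⟨rfl, hij⟩ := huniq p hp q hq _ _ _ hi' (hvw ▸ hj')
      obtain rfl : i = j := by omega
      exact Option.some.inj (hi.symm.trans hj)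
    · exact absurd (List.mem_of_getElem? (hvw.trans hfw ▸ hi')) (hnw p hp)
    · exact absurd (List.mem_of_getElem? (hvw.symm.trans hfv ▸ hj')) (hnv q hq)
    · exact hfv.symm.trans (hvw.trans hfw)
  · obtain ⟨q, hq, hhead⟩ := hX _ hfX
    rw [List.head?_eq_getElem?] at hhead
    rcases hf v hv with ⟨p, hp, i, hi, hi'⟩ | ⟨hfv, hnv⟩
    · have := (huniq p hp q hq _ _ _ hi' hhead).2
      omega
    · rw [hfv] at hhead
      exact hnv q hq (List.mem_of_getElem? hhead)
  · rcases hf v hv with ⟨p, hp, i, hi, hi'⟩ | ⟨hfv, -⟩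
    · right
      obtain ⟨h1, e1⟩ := List.getElem?_eq_some_iff.1 hi
      obtain ⟨h2, e2⟩ := List.getElem?_eq_some_iff.1 hi'
      have hc := List.isChain_iff_getElem.1 (hpath p hp).1.2 i h2
      rwa [e1, e2] at hc
    · exact .inl hfv.symm

/-- Iterates of a map that is injective on `Tᶜ` and avoids `X` determine their starting point
in `X` and the number of steps, as long as they start from `Tᶜ` at each step. -/
theorem iterate_eq_of_injOn_compl {V : Type*} {X T : Set V} {f : V → V} (hf : Set.InjOn f Tᶜ)
    (hfX : ∀ v ∈ Tᶜ, f v ∉ X) {x y : V} (hx : x ∈ X) (hy : y ∈ X) {i j : ℕ}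
    (hi : ∀ k < i, f^[k] x ∈ Tᶜ) (hj : ∀ k < j, f^[k] y ∈ Tᶜ) (h : f^[i] x = f^[j] y) :
    i = j ∧ x = y := by
  induction i generalizing j with
  | zero =>
    cases j with
    | zero => exact ⟨rfl, h⟩
    | succ j =>
      rw [Function.iterate_succ_apply'] at h
      exact absurd (h ▸ hx : f (f^[j] y) ∈ X) (hfX _ (hj j j.lt_succ_self))
  | succ i ih =>
    rw [Function.iterate_succ_apply'] at h
    cases j with
    | zero => exact absurd (h ▸ hy : f (f^[i] x) ∈ X) (hfX _ (hi i i.lt_succ_self))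
    | succ j =>
      rw [Function.iterate_succ_apply'] at h
      obtain ⟨rfl, hxy⟩ := ih (fun k hk => hi k (by omega)) (fun k hk => hj k (by omega))
        (hf (hi i i.lt_succ_self) (hj j j.lt_succ_self) h)
      exact ⟨rfl, hxy⟩

/-- Following an injection from `Tᶜ` to `Xᶜ` along arcs yields a routing from `X` to `T`. -/
theorem hasRouting_of_injOn {V : Type*} [Finite V] {A : Set (V × V)} {X T : Set V} {f : V → V}
    (hf : Set.InjOn f Tᶜ) (hfA : ∀ v ∈ Tᶜ, f v ∉ X ∧ (v = f v ∨ (v, f v) ∈ A)) :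
    HasRouting A X T := by
  classical
  have hfX : ∀ v ∈ Tᶜ, f v ∉ X := fun v hv => (hfA v hv).1
  have hex : ∀ x : X, ∃ k, f^[k] (x : V) ∈ T := by
    intro x
    by_contra! hT
    obtain ⟨i, j, hij, he⟩ := Finite.exists_ne_map_eq_of_infinite fun k : ℕ => f^[k] (x : V)
    exact hij (iterate_eq_of_injOn_compl hf hfX x.2 x.2 (fun k _ => hT k) (fun k _ => hT k) he).1
  let n : X → ℕ := fun x => Nat.find (hex x)
  have hn : ∀ x : X, f^[n x] (x : V) ∈ T := fun x => Nat.find_spec (hex x)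
  have hlt : ∀ x : X, ∀ k < n x, f^[k] (x : V) ∈ Tᶜ := fun x k hk => Nat.find_min (hex x) hk
  have huniq : ∀ x y : X, ∀ i < n x + 1, ∀ j < n y + 1, f^[i] (x : V) = f^[j] (y : V) →
      i = j ∧ (x : V) = y := fun x y i hi j hj he =>
    iterate_eq_of_injOn_compl hf hfX x.2 y.2 (fun k hk => hlt x k (by omega))
      (fun k hk => hlt y k (by omega)) he
  let p : X → List V := fun x => (List.range (n x + 1)).map fun k => f^[k] (x : V)
  refine ⟨Set.range p, ?_, fun x hx => ⟨p ⟨x, hx⟩, ⟨_, rfl⟩, by simp [p]⟩, ?_, ?_⟩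
  · rintro _ ⟨x, rfl⟩
    refine ⟨⟨by simp [p], ?_⟩, ?_⟩
    · refine List.isChain_iff_getElem.2 fun i hi => ?_
      have hi' : i < n x := by simpa [p] using hi
      simp only [p, List.getElem_map, List.getElem_range, Function.iterate_succ_apply']
      refine (hfA _ (hlt x i hi')).2.resolve_left fun he => ?_
      rw [← Function.iterate_succ_apply' f] at he
      have := (huniq x x i (by omega) (i + 1) (by omega) he).1
      omega
    · refine List.Nodup.map_on (fun i hi j hj he => ?_) List.nodup_range
      exact (huniq x x i (List.mem_range.1 hi) j (List.mem_range.1 hj) he).1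
  · rintro _ ⟨x, rfl⟩
    exact ⟨_, hn x, by simp [p, List.range_succ]⟩
  · rintro _ ⟨x, rfl⟩ _ ⟨y, rfl⟩
    by_cases hxy : x = y
    · exact .inl (congrArg p hxy)
    · refine .inr fun v hv hv' => ?_
      simp only [p, List.mem_map, List.mem_range] at hv hv'
      obtain ⟨i, hi, rfl⟩ := hv
      obtain ⟨j, hj, he⟩ := hv'
      exact hxy (Subtype.ext (huniq x y i hi j hj he.symm).2)

/-- Strict gammoids are representable over the reals by some finite-dimensional space. -/
theorem exists_hasRouting_iff_linearIndependent {V : Type*} [Finite V] (A : Set (V × V))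
    (T : Set V) :
    ∃ (S : Submodule ℝ (V → ℝ)) (φ : V → (V → ℝ) ⧸ S),
      ∀ X, HasRouting A X T ↔ LinearIndependent ℝ (fun x : X => φ x) := by
  classical
  obtain ⟨m, hmA, hm⟩ := exists_generic_matrix fun v w => v = w ∨ (v, w) ∈ A
  have hr : LinearIndependent ℝ (fun i : (Tᶜ : Set V) => m i) :=
    (hm Tᶜ id Function.injective_id.injOn fun v _ => .inl rfl).of_comp
      (LinearMap.funLeft ℝ ℝ (Subtype.val : (Tᶜ : Set V) → V))
  refine ⟨_, fun x => (Submodule.span ℝ (Set.range fun i : (Tᶜ : Set V) => m i)).mkQ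
    (Pi.single x 1), fun X => ?_⟩
  rw [linearIndependent_mkQ_single_iff hr X]
  constructor
  · intro h
    obtain ⟨f, hf, hfA⟩ := h.exists_injOn
    exact (hm Tᶜ f hf fun v hv => (hfA v hv).2).of_comp
      (LinearMap.funLeft ℝ ℝ fun j : (Tᶜ : Set V) => (⟨f j, (hfA j j.2).1⟩ : (Xᶜ : Set V)))
  · intro h
    obtain ⟨f, hf, hfm⟩ := exists_injective_entry_ne_zero h
    refine hasRouting_of_injOn (f := fun v => if hv : v ∈ Tᶜ then f ⟨v, hv⟩ else v) ?_ ?_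
    · intro v hv w hw hvw
      simp only [dif_pos hv, dif_pos hw] at hvw
      exact congrArg Subtype.val (hf (Subtype.ext hvw))
    · intro v hv
      simp only [dif_pos hv]
      exact ⟨(f ⟨v, hv⟩).2, hmA _ _ (hfm ⟨v, hv⟩)⟩

/-- Every gammoid is representable over the reals: there is a matrix with `rk Γ(D,T,E)` many
columns whose row independence coincides with independence in `Γ(D,T,E)`. -/
theorem gammoid_representable {V : Type*} [Fintype V] (A : Set (V × V)) (T E : Set V) :
    ∃ (n : ℕ) (μ : V → Fin n → ℝ),
      (∃ B, B ⊆ E ∧ HasRouting A B T ∧ B.ncard = n) ∧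
      (∀ X, X ⊆ E → HasRouting A X T → X.ncard ≤ n) ∧
      (∀ X, X ⊆ E → (HasRouting A X T ↔ LinearIndependent ℝ (fun x : X => μ x))) := by
  classical
  obtain ⟨S, φ, hφ⟩ := exists_hasRouting_iff_linearIndependent A T
  let U := Submodule.span ℝ (φ '' E)
  let e : U ≃ₗ[ℝ] (Fin (Module.finrank ℝ U) → ℝ) := (Module.finBasis ℝ U).equivFun
  let μ : V → Fin (Module.finrank ℝ U) → ℝ := fun v =>
    if hv : v ∈ E then e ⟨φ v, Submodule.subset_span ⟨v, hv, rfl⟩⟩ else 0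
  have hμ : ∀ X, X ⊆ E → (HasRouting A X T ↔ LinearIndependent ℝ (fun x : X => μ x)) := by
    intro X hX
    let ψ : X → U := fun x => ⟨φ x, Submodule.subset_span ⟨x, hX x.2, rfl⟩⟩
    have h1 : (fun x : X => μ x) = e.toLinearMap ∘ ψ := funext fun x => dif_pos (hX x.2)
    have h2 : (fun x : X => φ x) = U.subtype ∘ ψ := rfl
    rw [hφ, h1, h2, LinearMap.linearIndependent_iff _ (LinearEquiv.ker e),
      LinearMap.linearIndependent_iff _ U.ker_subtype]
  refine ⟨_, μ, ?_, fun X hX h => ?_, hμ⟩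
  · obtain ⟨B, hB, -, hspan, hli⟩ :=
      exists_linearIndepOn_extension (K := ℝ) (v := φ) (linearIndepOn_empty ℝ φ)
        (Set.empty_subset E)
    refine ⟨B, hB, (hφ B).2 hli, ?_⟩
    have hU : U = Submodule.span ℝ (Set.range fun x : B => φ x) := by
      rw [← Set.image_eq_range]
      exact le_antisymm (Submodule.span_le.2 hspan)
        (Submodule.span_mono (Set.image_mono hB))
    rw [hU, finrank_span_eq_card hli, ← Nat.card_eq_fintype_card, Nat.card_coe_set_eq]
  · have := ((hμ X hX).1 h).fintype_card_le_finrank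
    rwa [Module.finrank_fin_fun, ← Nat.card_eq_fintype_card, Nat.card_coe_set_eq] at this
end

section
/- (Lindström) Let D = (V,A) be an acyclic digraph, n ∈ ℕ, S = {s₁,…,s_n} ⊆ V and T = {t₁,…,t_n} ⊆ V equicardinal ordered subsets, and w: A → ℝ an indeterminate weighting of D. Define μ ∈ ℝ^{V×V} by μ(u,v) = Σ_{p path from u to v in D} ∏_{a∈|p|_A} w(a). Then det(μ|S×T) = Σ_{L: S⇉T linking} sgn(L)·∏_{p∈L} ∏_{a∈|p|_A} w(a), where the sum ranges over all linkings L from S onto T in D, and sgn(L) = sgn(σ) for the unique permutation σ of {1,…,n} such that for each i there is a path in L from s_i to t_{σ(i)}. -/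
namespace Lindstrom

open Finset

variable {V : Type*} {A : Set (V × V)} {w : V × V → ℝ}

/-- In an acyclic digraph, the vertices of a walk are pairwise distinct. -/
theorem nodup_of_isChain (hA : ∀ p : List V, ¬ IsCycle A p) {p : List V}
    (hp : p.IsChain fun u v => (u, v) ∈ A) : p.Nodup := by
  induction p with
  | nil => exact List.nodup_nil
  | cons a q ih =>
    have hq := ih hp.of_cons
    refine List.nodup_cons.2 ⟨fun ha => ?_, hq⟩
    obtain ⟨l₁, l₂, rfl⟩ := List.append_of_mem ha
    have hc : (a :: l₁ ++ [a]).IsChain fun u v => (u, v) ∈ A :=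
      (List.isChain_split (l₁ := a :: l₁).1 hp).1
    have hd : (a :: l₁ ++ [a]).dropLast = a :: l₁ := List.dropLast_concat
    refine hA (a :: l₁ ++ [a]) ⟨⟨by simp, hc⟩, by simp, List.getLast?_concat.symm, ?_⟩
    rw [hd]
    refine ⟨⟨by simp, hc.left_of_append⟩, ?_⟩
    rw [List.nodup_append] at hq
    exact List.nodup_cons.2 ⟨fun h => hq.2.2 a h a (by simp) rfl, hq.1⟩

theorem isPath_iff (hA : ∀ p : List V, ¬ IsCycle A p) {p : List V} :
    IsPath A p ↔ p ≠ [] ∧ p.IsChain fun u v => (u, v) ∈ A :=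
  ⟨fun h => h.1, fun h => ⟨h, nodup_of_isChain hA h.2⟩⟩

theorem pathProd_append_cons (l₁ l₂ : List V) (c : V) :
    pathProd w (l₁ ++ c :: l₂) = pathProd w (l₁ ++ [c]) * pathProd w (c :: l₂) := by
  induction l₁ with
  | nil => simp [pathProd]
  | cons a l ih =>
    cases l with
    | nil => simp [pathProd]
    | cons b l =>
      simp only [pathProd, List.cons_append, List.tail_cons, List.zip_cons_cons, List.map_cons,
        List.prod_cons] at ih ⊢
      rw [ih, mul_assoc]

section Splice

variable [DecidableEq V]

/-- Follow `p` up to the first visit of `v`, then continue along `q` from its first visit of `v`. -/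
def splice (v : V) (p q : List V) : List V :=
  p.takeWhile (· ≠ v) ++ q.dropWhile (· ≠ v)

/-- The walks `p` and `q` can exchange their tails at `v`: they either agree or both visit `v`. -/
def Exchangeable (v : V) (p q : List V) : Prop :=
  p = q ∨ v ∈ p ∧ v ∈ q

@[simp]
theorem splice_self (v : V) (p : List V) : splice v p p = p :=
  List.takeWhile_append_dropWhile

theorem splice_append_cons {v : V} {p₁ p₂ q₁ q₂ : List V} (hp : v ∉ p₁) (hq : v ∉ q₁) :
    splice v (p₁ ++ v :: p₂) (q₁ ++ v :: q₂) = p₁ ++ v :: q₂ := by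
  have h : ∀ {l : List V}, v ∉ l → ∀ a ∈ l, decide (a ≠ v) = true := by
    intro l hl a ha
    simpa using ne_of_mem_of_not_mem ha hl
  rw [splice, List.takeWhile_append_of_pos (h hp), List.dropWhile_append_of_pos (h hq)]
  simp

theorem exists_first_visit {v : V} {p : List V} (h : v ∈ p) :
    ∃ p₁ p₂, v ∉ p₁ ∧ p = p₁ ++ v :: p₂ := by
  obtain ⟨p₁, p₂, h₁, h₂, -⟩ := List.exists_erase_eq h
  exact ⟨p₁, p₂, h₁, h₂⟩

/-- To prove a property of exchangeable walks, it suffices to consider equal walks,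
and walks split at their first visit of `v`. -/
theorem Exchangeable.induction {v : V}
    {motive : ∀ p q : List V, Exchangeable v p q → Prop}
    (self : ∀ p, motive p p (.inl rfl))
    (split : ∀ p₁ p₂ q₁ q₂, v ∉ p₁ → v ∉ q₁ →
      motive (p₁ ++ v :: p₂) (q₁ ++ v :: q₂) (.inr ⟨by simp, by simp⟩))
    {p q : List V} (h : Exchangeable v p q) : motive p q h := by
  obtain rfl | ⟨hp, hq⟩ := h
  · exact self p
  · obtain ⟨p₁, p₂, hp₁, rfl⟩ := exists_first_visit hp
    obtain ⟨q₁, q₂, hq₁, rfl⟩ := exists_first_visit hq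
    exact split p₁ p₂ q₁ q₂ hp₁ hq₁

theorem splice_splice {v : V} {p q : List V} (h : Exchangeable v p q) :
    splice v (splice v p q) (splice v q p) = p := by
  induction h using Exchangeable.induction with
  | self p => simp
  | split p₁ p₂ q₁ q₂ hp hq =>
    rw [splice_append_cons hp hq, splice_append_cons hq hp, splice_append_cons hp hq]

theorem mem_splice_self {v : V} {p q : List V} (h : Exchangeable v p q) :
    v ∈ splice v p q ↔ v ∈ p := by
  induction h using Exchangeable.induction with
  | self p => simp
  | split p₁ p₂ q₁ q₂ hp hq => simp [splice_append_cons hp hq]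

theorem head?_splice {v : V} {p q : List V} (h : Exchangeable v p q) :
    (splice v p q).head? = p.head? := by
  induction h using Exchangeable.induction with
  | self p => simp
  | split p₁ p₂ q₁ q₂ hp hq => simp [splice_append_cons hp hq, List.head?_append]

theorem getLast?_splice {v : V} {p q : List V} (h : Exchangeable v p q) :
    (splice v p q).getLast? = q.getLast? := by
  induction h using Exchangeable.induction with
  | self p => simp
  | split p₁ p₂ q₁ q₂ hp hq => simp [splice_append_cons hp hq, List.getLast?_append, List.getLast?_cons]

theorem isPath_splice (hA : ∀ p : List V, ¬ IsCycle A p) {v : V} {p q : List V}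
    (h : Exchangeable v p q) (hp : IsPath A p) (hq : IsPath A q) : IsPath A (splice v p q) := by
  rw [isPath_iff hA] at *
  induction h using Exchangeable.induction with
  | self p => simpa using hp
  | split p₁ p₂ q₁ q₂ hp₁ hq₁ =>
    rw [splice_append_cons hp₁ hq₁]
    exact ⟨by simp, List.isChain_split.2
      ⟨(List.isChain_split.1 hp.2).1, (List.isChain_split.1 hq.2).2⟩⟩

theorem pathProd_splice {v : V} {p q : List V} (h : Exchangeable v p q) :
    pathProd w (splice v p q) =
      pathProd w (p.takeWhile (· ≠ v) ++ if v ∈ p then [v] else []) *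
        pathProd w (q.dropWhile (· ≠ v)) := by
  have key : ∀ {l₁ l₂ r₁ r₂ : List V}, v ∉ l₁ → v ∉ r₁ →
      pathProd w (splice v (l₁ ++ v :: l₂) (r₁ ++ v :: r₂)) =
        pathProd w ((l₁ ++ v :: l₂).takeWhile (· ≠ v) ++
          if v ∈ l₁ ++ v :: l₂ then [v] else []) *
        pathProd w ((r₁ ++ v :: r₂).dropWhile (· ≠ v)) := by
    intro l₁ l₂ r₁ r₂ hl hr
    have hpos : ∀ {l : List V}, v ∉ l → ∀ a ∈ l, decide (a ≠ v) = true := by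
      intro l hl a ha
      simpa using ne_of_mem_of_not_mem ha hl
    rw [splice_append_cons hl hr, pathProd_append_cons,
      List.takeWhile_append_of_pos (hpos hl), List.dropWhile_append_of_pos (hpos hr)]
    simp
  induction h using Exchangeable.induction with
  | self p =>
    by_cases hv : v ∈ p
    · obtain ⟨p₁, p₂, hp₁, rfl⟩ := exists_first_visit hv
      exact key hp₁ hp₁
    · have hpos : ∀ a ∈ p, decide (a ≠ v) = true := by
        intro a ha
        simpa using ne_of_mem_of_not_mem ha hv
      rw [List.takeWhile_eq_self_iff.2 hpos, List.dropWhile_eq_nil_iff.2 hpos]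
      simp [hv, pathProd]
  | split p₁ p₂ q₁ q₂ hp hq => exact key hp hq

end Splice

section TailSwap

variable {ι : Type*}

/-- The vertices visited by at least two members of a family of walks. -/
def sharedVertices (P : ι → List V) : Set V :=
  {u | ∃ k l, k ≠ l ∧ u ∈ P k ∧ u ∈ P l}

theorem not_nonempty_sharedVertices {P : ι → List V} :
    ¬ (sharedVertices P).Nonempty ↔ ∀ k l, k ≠ l → ∀ u ∈ P k, u ∉ P l := by
  simp only [Set.Nonempty, sharedVertices, Set.mem_ofPred_eq]
  grind

variable [DecidableEq V]

/-- Exchange the tails at `v` of the walks of a family `P` according to the permutation `τ`. -/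
def tailSwap (v : V) (τ : Equiv.Perm ι) (P : ι → List V) (k : ι) : List V :=
  splice v (P k) (P (τ k))

variable {v : V} {τ : Equiv.Perm ι} {P : ι → List V}

theorem tailSwap_tailSwap (hτ : ∀ k, τ (τ k) = k) (h : ∀ k, Exchangeable v (P k) (P (τ k))) :
    tailSwap v τ (tailSwap v τ P) = P := by
  funext k
  simp only [tailSwap, hτ]
  exact splice_splice (h k)

theorem exchangeable_tailSwap (hτ : ∀ k, τ (τ k) = k)
    (h : ∀ k, Exchangeable v (P k) (P (τ k))) (k : ι) :
    Exchangeable v (tailSwap v τ P k) (tailSwap v τ P (τ k)) := by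
  obtain hk | hk := h k
  · left
    simp [tailSwap, hτ, hk]
  · exact .inr ⟨(mem_splice_self (h k)).2 hk.1, (mem_splice_self (h (τ k))).2 hk.2⟩

theorem sharedVertices_subset_tailSwap (hτ : ∀ k, τ (τ k) = k)
    (hnd : ∀ k, (tailSwap v τ P k).Nodup) :
    sharedVertices P ⊆ sharedVertices (tailSwap v τ P) := by
  have hsplit : ∀ {u : V} {k : ι}, u ∈ P k →
      u ∈ (P k).takeWhile (· ≠ v) ∨ u ∈ (P k).dropWhile (· ≠ v) := fun hu =>
    List.mem_append.1 (by rwa [List.takeWhile_append_dropWhile])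
  have hpre : ∀ {u : V} {k : ι}, u ∈ (P k).takeWhile (· ≠ v) → u ∈ tailSwap v τ P k :=
    fun hu => List.mem_append_left _ hu
  have hsuf : ∀ {u : V} {k : ι}, u ∈ (P k).dropWhile (· ≠ v) → u ∈ tailSwap v τ P (τ k) := by
    intro u k hu
    refine List.mem_append_right _ ?_
    rwa [hτ]
  have hne : ∀ {u : V} {k l : ι}, u ∈ (P k).takeWhile (· ≠ v) →
      u ∈ (P l).dropWhile (· ≠ v) → k ≠ τ l := by
    rintro u k l hk hl rfl
    refine (List.nodup_append.1 (hnd (τ l))).2.2 u hk u ?_ rfl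
    rwa [hτ]
  rintro u ⟨k, l, hkl, hk, hl⟩
  obtain hk | hk := hsplit hk <;> obtain hl | hl := hsplit hl
  · exact ⟨k, l, hkl, hpre hk, hpre hl⟩
  · exact ⟨k, τ l, hne hk hl, hpre hk, hsuf hl⟩
  · exact ⟨τ k, l, (hne hl hk).symm, hsuf hk, hpre hl⟩
  · exact ⟨τ k, τ l, τ.injective.ne hkl, hsuf hk, hsuf hl⟩

theorem sharedVertices_tailSwap (hτ : ∀ k, τ (τ k) = k)
    (h : ∀ k, Exchangeable v (P k) (P (τ k))) (hP : ∀ k, (P k).Nodup)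
    (hnd : ∀ k, (tailSwap v τ P k).Nodup) :
    sharedVertices (tailSwap v τ P) = sharedVertices P := by
  refine (Set.Subset.antisymm (sharedVertices_subset_tailSwap hτ hnd) ?_).symm
  have := sharedVertices_subset_tailSwap (v := v) (P := tailSwap v τ P) hτ
    (by rwa [tailSwap_tailSwap hτ h])
  rwa [tailSwap_tailSwap hτ h] at this

theorem prod_pathProd_tailSwap [Fintype ι] (h : ∀ k, Exchangeable v (P k) (P (τ k))) :
    ∏ k, pathProd w (tailSwap v τ P k) = ∏ k, pathProd w (P k) := by
  simp only [tailSwap, fun k => pathProd_splice (w := w) (h k), prod_mul_distrib]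
  rw [Equiv.prod_comp τ fun k => pathProd w ((P k).dropWhile (· ≠ v)), ← prod_mul_distrib]
  refine prod_congr rfl fun k _ => ?_
  rw [← pathProd_splice (.inl rfl), splice_self]

end TailSwap

/-- There is a choice, for each family of walks sharing a vertex, of a vertex `v` and a
transposition `τ` along which the family can exchange its tails at `v`. The choice only depends on
the set of shared vertices and on which walks visit `v`. -/
theorem exists_pivot (V ι : Type*) [Nonempty V] [DecidableEq ι] :
    ∃ (v : (ι → List V) → V) (τ : (ι → List V) → Equiv.Perm ι),
      ∀ P, (sharedVertices P).Nonempty →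
        (τ P).IsSwap ∧ (∀ k, Exchangeable (v P) (P k) (P (τ P k))) ∧
        ∀ Q, sharedVertices Q = sharedVertices P → (∀ k, v P ∈ Q k ↔ v P ∈ P k) →
          v Q = v P ∧ τ Q = τ P := by
  have hc : ∀ B : Set V, ∃ v, B.Nonempty → v ∈ B := fun B => by
    by_cases h : B.Nonempty
    · exact ⟨h.some, fun _ => h.some_mem⟩
    · exact ⟨Classical.arbitrary V, fun h' => absurd h' h⟩
  have hd : ∀ K : Set ι, ∃ τ : Equiv.Perm ι,
      K.Nontrivial → τ.IsSwap ∧ ∀ k, τ k = k ∨ k ∈ K ∧ τ k ∈ K := fun K => by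
    by_cases h : K.Nontrivial
    · obtain ⟨i, hi, j, hj, hij⟩ := h
      refine ⟨Equiv.swap i j, fun _ => ⟨⟨i, j, hij, rfl⟩, fun k => ?_⟩⟩
      obtain rfl | hki := eq_or_ne k i
      · simp [hi, hj]
      obtain rfl | hkj := eq_or_ne k j
      · simp [hi, hj]
      · exact .inl (Equiv.swap_apply_of_ne_of_ne hki hkj)
    · exact ⟨1, fun h' => absurd h' h⟩
  choose c hc using hc
  choose d hd using hd
  refine ⟨fun P => c (sharedVertices P), fun P => d {k | c (sharedVertices P) ∈ P k},
    fun P hP => ?_⟩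
  obtain ⟨k, l, hkl, hk, hl⟩ := hc _ hP
  obtain ⟨hswap, hmem⟩ := hd {k | c (sharedVertices P) ∈ P k} ⟨k, hk, l, hl, hkl⟩
  refine ⟨hswap, fun k => (hmem k).imp (fun h => by rw [h]) id, fun Q hQ hv => ?_⟩
  simp only [hQ, hv, and_self]

/-- The paths from `u` to `v`. -/
def pathSet (A : Set (V × V)) (u v : V) : Set (List V) :=
  {p | IsPath A p ∧ p.head? = some u ∧ p.getLast? = some v}

theorem finite_pathSet [Finite V] (A : Set (V × V)) (u v : V) : (pathSet A u v).Finite := by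
  have := Fintype.ofFinite V
  exact (List.finite_length_le V (Fintype.card V)).subset fun p hp => hp.1.2.length_le_card

section Families

variable {ι : Type*} [Fintype ι] [DecidableEq ι] [Finite V]

/-- The families of paths in which the `k`-th path leads from `s k` to `t k`. -/
noncomputable def pathFamilies (A : Set (V × V)) (s t : ι → V) : Finset (ι → List V) :=
  Fintype.piFinset fun k => (finite_pathSet A (s k) (t k)).toFinset

theorem mem_pathFamilies {s t : ι → V} {P : ι → List V} :
    P ∈ pathFamilies A s t ↔
      ∀ k, IsPath A (P k) ∧ (P k).head? = some (s k) ∧ (P k).getLast? = some (t k) := by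
  simp [pathFamilies, pathSet]

theorem det_pathMatrix (A : Set (V × V)) (w : V × V → ℝ) (s t : ι → V) :
    (Matrix.of fun i j => pathMatrix A w (s i) (t j)).det =
      ∑ σ : Equiv.Perm ι, ((Equiv.Perm.sign σ : ℤ) : ℝ) *
        ∑ P ∈ pathFamilies A s (t ∘ σ), ∏ k, pathProd w (P k) := by
  rw [← Matrix.det_transpose, Matrix.det_apply']
  refine sum_congr rfl fun σ _ => ?_
  rw [pathFamilies, ← prod_univ_sum]
  congr 1
  refine prod_congr rfl fun k _ => ?_
  exact finsum_mem_eq_finite_toFinset_sum _ (finite_pathSet A (s k) (t (σ k)))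

open Classical in
/-- The contributions of the families of paths sharing a vertex cancel. -/
theorem sum_sharing_pathFamilies (hA : ∀ p : List V, ¬ IsCycle A p) (w : V × V → ℝ)
    (s t : ι → V) :
    ∑ σ : Equiv.Perm ι, ((Equiv.Perm.sign σ : ℤ) : ℝ) *
      ∑ P ∈ pathFamilies A s (t ∘ σ) with (sharedVertices P).Nonempty,
        ∏ k, pathProd w (P k) = 0 := by
  obtain hV | hV := isEmpty_or_nonempty V
  · simp [Set.eq_empty_of_isEmpty]
  obtain ⟨v, τ, hpivot⟩ := exists_pivot V ι
  have hinv : ∀ {P : ι → List V}, (sharedVertices P).Nonempty → ∀ k, τ P (τ P k) = k := by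
    intro P hP k
    obtain ⟨i, j, -, h⟩ := (hpivot P hP).1
    simp [h]
  have hpath : ∀ {σ : Equiv.Perm ι} {P : ι → List V}, (sharedVertices P).Nonempty →
      P ∈ pathFamilies A s (t ∘ σ) →
      tailSwap (v P) (τ P) P ∈ pathFamilies A s (t ∘ (σ * τ P)) := by
    intro σ P hP hmem
    rw [mem_pathFamilies] at hmem ⊢
    intro k
    have hk := (hpivot P hP).2.1 k
    exact ⟨isPath_splice hA hk (hmem k).1 (hmem _).1, (head?_splice hk).trans (hmem k).2.1,
      (getLast?_splice hk).trans (hmem _).2.2⟩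
  have hshared : ∀ {σ : Equiv.Perm ι} {P : ι → List V}, (sharedVertices P).Nonempty →
      P ∈ pathFamilies A s (t ∘ σ) →
      sharedVertices (tailSwap (v P) (τ P) P) = sharedVertices P := fun {σ P} hP hmem =>
    sharedVertices_tailSwap (hinv hP) (hpivot P hP).2.1
      (fun k => (mem_pathFamilies.1 hmem k).1.2)
      fun k => (mem_pathFamilies.1 (hpath hP hmem) k).1.2
  simp only [mul_sum]
  rw [sum_sigma']
  refine sum_involution (fun a _ => ⟨a.1 * τ a.2, tailSwap (v a.2) (τ a.2) a.2⟩) ?_ ?_ ?_ ?_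
  · rintro ⟨σ, P⟩ ha
    simp only [mem_sigma, mem_univ, true_and, mem_filter] at ha
    have hsign := (hpivot P ha.2).1.sign_eq
    simp [prod_pathProd_tailSwap (hpivot P ha.2).2.1, hsign]
  · rintro ⟨σ, P⟩ ha - heq
    simp only [mem_sigma, mem_univ, true_and, mem_filter] at ha
    have hsign := (hpivot P ha.2).1.sign_eq
    have h1 : σ * τ P = σ := congrArg Sigma.fst heq
    rw [mul_eq_left.1 h1, Equiv.Perm.sign_one] at hsign
    exact absurd hsign (by decide)
  · rintro ⟨σ, P⟩ ha
    simp only [mem_sigma, mem_univ, true_and, mem_filter] at ha ⊢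
    exact ⟨hpath ha.2 ha.1, by rw [hshared ha.2 ha.1]; exact ha.2⟩
  · rintro ⟨σ, P⟩ ha
    simp only [mem_sigma, mem_univ, true_and, mem_filter] at ha
    obtain ⟨-, hex, hfix⟩ := hpivot P ha.2
    obtain ⟨hv, hτ⟩ := hfix _ (hshared ha.2 ha.1) fun k => mem_splice_self (hex k)
    have hsq : τ P * τ P = 1 := Equiv.ext (hinv ha.2)
    simp only [hv, hτ, tailSwap_tailSwap (hinv ha.2) hex, mul_assoc, hsq, mul_one]

/-- The range of a family of paths with distinct sources determines the family. -/
theorem eq_of_range_eq {s t : ι → V} (hs : Function.Injective s) {P Q : ι → List V}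
    (hP : P ∈ pathFamilies A s t) (hQ : Q ∈ pathFamilies A s t)
    (h : Set.range P = Set.range Q) : P = Q := by
  funext k
  obtain ⟨l, hl⟩ := h ▸ Set.mem_range_self (f := P) k
  have hlk := (mem_pathFamilies.1 hQ l).2.1
  rw [hl, (mem_pathFamilies.1 hP k).2.1, Option.some_inj] at hlk
  rw [← hl, hs hlk]

theorem injective_of_mem_pathFamilies {s t : ι → V} (hs : Function.Injective s)
    {P : ι → List V} (hP : P ∈ pathFamilies A s t) : Function.Injective P := by
  intro k l hkl
  have hk := (mem_pathFamilies.1 hP k).2.1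
  rw [hkl, (mem_pathFamilies.1 hP l).2.1, Option.some_inj] at hk
  exact (hs hk).symm

/-- The linkings are the ranges of the families of disjoint paths. -/
theorem setOf_isLinking_eq_image {s t : ι → V} (hs : Function.Injective s)
    (σ : Equiv.Perm ι) :
    {L : Set (List V) | IsLinking A L (Set.range s) (Set.range t) ∧
        ∀ i, ∃ p ∈ L, p.head? = some (s i) ∧ p.getLast? = some (t (σ i))} =
      Set.range '' {P | P ∈ pathFamilies A s (t ∘ σ) ∧ ¬ (sharedVertices P).Nonempty} := by
  ext L
  simp only [Set.mem_ofPred_eq, Set.mem_image, not_nonempty_sharedVertices, mem_pathFamilies,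
    Function.comp_apply]
  constructor
  · rintro ⟨⟨⟨hpath, -, hlast, hdisj⟩, -⟩, hL⟩
    choose P hPL hhead hend using hL
    refine ⟨P, ⟨fun k => ⟨hpath _ (hPL k), hhead k, hend k⟩, fun k l hkl => ?_⟩, ?_⟩
    · refine (hdisj _ (hPL k) _ (hPL l)).resolve_left fun h => hkl (hs ?_)
      rw [← Option.some_inj, ← hhead k, ← hhead l, h]
    · refine Set.Subset.antisymm (Set.range_subset_iff.2 hPL) fun p hp => ?_
      obtain ⟨_, ⟨j, rfl⟩, hj⟩ := hlast p hp
      refine ⟨σ.symm j, (hdisj _ (hPL _) _ hp).resolve_right fun h => ?_⟩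
      refine h (t j) (List.mem_of_getLast? ?_) (List.mem_of_getLast? hj)
      simpa using hend (σ.symm j)
  · rintro ⟨P, ⟨hP, hdisj⟩, rfl⟩
    refine ⟨⟨⟨?_, ?_, ?_, ?_⟩, ?_⟩, fun i => ⟨P i, ⟨i, rfl⟩, (hP i).2⟩⟩
    · rintro _ ⟨k, rfl⟩
      exact (hP k).1
    · rintro _ ⟨k, rfl⟩
      exact ⟨P k, ⟨k, rfl⟩, (hP k).2.1⟩
    · rintro _ ⟨k, rfl⟩
      exact ⟨t (σ k), ⟨σ k, rfl⟩, (hP k).2.2⟩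
    · rintro _ ⟨k, rfl⟩ _ ⟨l, rfl⟩
      obtain rfl | hkl := eq_or_ne k l
      · exact .inl rfl
      · exact .inr (hdisj k l hkl)
    · ext y
      constructor
      · rintro ⟨_, ⟨k, rfl⟩, hk⟩
        rw [(hP k).2.2, Option.some_inj] at hk
        exact ⟨σ k, hk⟩
      · rintro ⟨j, rfl⟩
        exact ⟨P (σ.symm j), ⟨_, rfl⟩, by simpa using (hP (σ.symm j)).2.2⟩

open Classical in
theorem finsum_isLinking {s t : ι → V} (hs : Function.Injective s) (w : V × V → ℝ)
    (σ : Equiv.Perm ι) :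
    ∑ᶠ L ∈ {L : Set (List V) | IsLinking A L (Set.range s) (Set.range t) ∧
        ∀ i, ∃ p ∈ L, p.head? = some (s i) ∧ p.getLast? = some (t (σ i))},
      ∏ᶠ p ∈ L, pathProd w p =
    ∑ P ∈ pathFamilies A s (t ∘ σ) with ¬ (sharedVertices P).Nonempty,
      ∏ k, pathProd w (P k) := by
  rw [setOf_isLinking_eq_image hs, finsum_mem_image fun P hP Q hQ => eq_of_range_eq hs hP.1 hQ.1,
    ← coe_filter, finsum_mem_coe_finset]
  refine sum_congr rfl fun P hP => ?_
  rw [finprod_mem_range (injective_of_mem_pathFamilies hs (mem_filter.1 hP).1),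
    finprod_eq_prod_of_fintype]

end Families

end Lindstrom

/-- Lindström's Lemma: for an acyclic digraph with an indeterminate weighting, the determinant
of the path matrix restricted to `S × T` is the signed sum over all linkings from `S` onto `T`
of the products of the arc weights (grouped by the permutation each linking realizes). -/
theorem lindstrom_lemma {V : Type*} [Fintype V] (A : Set (V × V))
    (hacyclic : ∀ p : List V, ¬ IsCycle A p)
    (w : V × V → ℝ) (hw : IsIndetWeighting A w)
    (n : ℕ) (s t : Fin n → V) (hs : Function.Injective s) (ht : Function.Injective t) :
    (Matrix.of fun i j => pathMatrix A w (s i) (t j)).det =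
      ∑ σ : Equiv.Perm (Fin n), ((Equiv.Perm.sign σ : ℤ) : ℝ) *
        ∑ᶠ L ∈ {L : Set (List V) | IsLinking A L (Set.range s) (Set.range t) ∧
            ∀ i, ∃ p ∈ L, p.head? = some (s i) ∧ p.getLast? = some (t (σ i))},
          ∏ᶠ p ∈ L, pathProd w p := by
  classical
  simp only [Lindstrom.finsum_isLinking hs]
  rw [Lindstrom.det_pathMatrix]
  refine Eq.trans ?_ (zero_add _)
  rw [← Lindstrom.sum_sharing_pathFamilies hacyclic w s t, ← Finset.sum_add_distrib]
  refine Finset.sum_congr rfl fun σ _ => ?_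
  rw [← mul_add, Finset.sum_filter_add_sum_filter_not]
end

section
/- Let D = (V,A) be a digraph and (σ,≪) a heavy arc signature of D. Then there exists a (σ,≪)-weighting of D, i.e., an indeterminate weighting w: A → ℝ such that for every a ∈ A: |w(a)| ≥ 1, sgn(w(a)) = σ(a), and Σ_{L ⊆ {x∈A : x ≪ a, x ≠ a}} ∏_{x∈L} |w(x)| < |w(a)|. -/
theorem exists_algebraicIndependent_real (ι : Type*) [Finite ι] :
    ∃ x : ι → ℝ, AlgebraicIndependent ℚ x := by
  obtain ⟨s, hs⟩ := exists_isTranscendenceBasis ℚ ℝ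
  have hinf : Infinite s := by
    by_contra hfin
    rw [not_infinite_iff_finite] at hfin
    have : Countable (Algebra.adjoin ℚ (Set.range ((↑) : s → ℝ))) :=
      have : Countable (MvPolynomial s ℚ) := by
        rw [← Cardinal.mk_le_aleph0_iff]
        exact MvPolynomial.cardinalMk_le_max_lift.trans (by simp)
      hs.1.aevalEquiv.symm.injective.countable
    have halg := hs.isAlgebraic
    refine Set.not_countable_univ (α := ℝ) ((Algebraic.countable
      (Algebra.adjoin ℚ (Set.range ((↑) : s → ℝ))) ℝ).mono fun x _ => ?_)
    exact halg.isAlgebraic x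
  obtain ⟨n, ⟨e⟩⟩ := Finite.exists_equiv_fin ι
  exact ⟨_, hs.1.comp (fun i => Infinite.natEmbedding s (e i))
    ((Infinite.natEmbedding s).injective.comp (Fin.val_injective.comp e.injective))⟩

theorem AlgebraicIndependent.smul_notMem_adjoin {ι K E : Type*} [Field K] [Field E] [Algebra K E]
    {x : ι → E} (hx : AlgebraicIndependent K x) {q : ι → K} (hq : ∀ i, q i ≠ 0) (i : ι) :
    q i • x i ∉ Algebra.adjoin K ((fun j => q j • x j) '' {i}ᶜ) := by
  intro hmem
  have hle : Algebra.adjoin K ((fun j => q j • x j) '' {i}ᶜ) ≤ Algebra.adjoin K (x '' {i}ᶜ) := by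
    refine Algebra.adjoin_le ?_
    rintro _ ⟨j, hj, rfl⟩
    exact Subalgebra.smul_mem _ (Algebra.subset_adjoin (Set.mem_image_of_mem x hj)) _
  have hxi : x i ∈ Algebra.adjoin K (x '' {i}ᶜ) := by
    simpa [smul_smul, inv_mul_cancel₀ (hq i)] using Subalgebra.smul_mem _ (hle hmem) (q i)⁻¹
  exact hx.transcendental_adjoin (s := {i}ᶜ) (i := i) (by simp)
    (isAlgebraic_algebraMap (⟨x i, hxi⟩ : Algebra.adjoin K (x '' {i}ᶜ)))

theorem exists_rat_smul_abs_mem_Ioo_sign_eq {x σ M : ℝ} (hx : x ≠ 0) (hσ : σ = 1 ∨ σ = -1)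
    (hM : 0 ≤ M) :
    ∃ q : ℚ, q ≠ 0 ∧ |q • x| ∈ Set.Ioo M (M + 1) ∧ Real.sign (q • x) = σ := by
  have hx' : 0 < |x| := abs_pos.2 hx
  obtain ⟨q, hq₁, hq₂⟩ := exists_rat_btwn ((div_lt_div_iff_of_pos_right hx').2 (lt_add_one M))
  rw [div_lt_iff₀ hx'] at hq₁
  rw [lt_div_iff₀ hx'] at hq₂
  have hq : (0 : ℝ) < q := pos_of_mul_pos_left (hM.trans_lt hq₁) hx'.le
  have hq0 : q ≠ 0 := by rintro rfl; simp at hq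
  rcases hx.lt_or_gt with h | h <;> rcases hσ with rfl | rfl
  · refine ⟨-q, neg_ne_zero.2 hq0, ?_, ?_⟩
    · simpa [Rat.smul_def, abs_mul, abs_of_pos hq] using ⟨hq₁, hq₂⟩
    · exact Real.sign_of_pos (by simp [Rat.smul_def]; nlinarith)
  · refine ⟨q, hq0, ?_, ?_⟩
    · simpa [Rat.smul_def, abs_mul, abs_of_pos hq] using ⟨hq₁, hq₂⟩
    · exact Real.sign_of_neg (by simp [Rat.smul_def]; nlinarith)
  · refine ⟨q, hq0, ?_, ?_⟩
    · simpa [Rat.smul_def, abs_mul, abs_of_pos hq] using ⟨hq₁, hq₂⟩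
    · exact Real.sign_of_pos (by simp [Rat.smul_def]; nlinarith)
  · refine ⟨-q, neg_ne_zero.2 hq0, ?_, ?_⟩
    · simpa [Rat.smul_def, abs_mul, abs_of_pos hq] using ⟨hq₁, hq₂⟩
    · exact Real.sign_of_neg (by simp [Rat.smul_def]; nlinarith)

theorem prod_range_three_pow_two_pow_add_two_le (k : ℕ) :
    ∏ i ∈ Finset.range k, ((3 : ℝ) ^ 2 ^ i + 2) ≤ 3 ^ 2 ^ k - 2 := by
  induction k with
  | zero => norm_num
  | succ k ih =>
    rw [Finset.prod_range_succ, pow_succ 2 k, pow_mul]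
    have : (0 : ℝ) < 3 ^ 2 ^ k := by positivity
    nlinarith [mul_le_mul_of_nonneg_right ih (by positivity : (0 : ℝ) ≤ 3 ^ 2 ^ k + 2)]

theorem finsum_mem_subset_finprod_eq_prod_add_one {α R : Type*} [CommSemiring R]
    (s : Finset α) (f : α → R) :
    ∑ᶠ L ∈ {L : Set α | L ⊆ s}, ∏ᶠ x ∈ L, f x = ∏ x ∈ s, (f x + 1) := by
  have hset : {L : Set α | L ⊆ s} = (↑) '' (s.powerset : Set (Finset α)) := by
    ext L
    constructor
    · intro hL
      lift L to Finset α using s.finite_toSet.subset hL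
      exact ⟨L, by simpa using hL, rfl⟩
    · rintro ⟨t, ht, rfl⟩
      simpa using ht
  rw [hset, finsum_mem_image Finset.coe_injective.injOn, finsum_mem_coe_finset,
    Finset.prod_add_one]
  simp_rw [finprod_mem_coe_finset]

theorem IsLinearOrderOn.exists_injOn_nat {β : Type*} {A : Set β} {r : β → β → Prop}
    (hr : IsLinearOrderOn A r) (hA : A.Finite) :
    ∃ k : β → ℕ, Set.InjOn k A ∧ ∀ a ∈ A, ∀ x ∈ A, r x a → x ≠ a → k x < k a := by
  obtain ⟨-, hanti, htrans, htotal⟩ := hr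
  let k : β → ℕ := fun a => {x ∈ A | r x a ∧ x ≠ a}.ncard
  have hlt : ∀ a ∈ A, ∀ x ∈ A, r x a → x ≠ a → k x < k a := by
    intro a ha x hx hxa hne
    refine Set.ncard_lt_ncard ⟨?_, fun h => ?_⟩ (hA.subset (Set.sep_subset _ _))
    · rintro y ⟨hy, hyx, -⟩
      refine ⟨hy, htrans y hy x hx a ha hyx hxa, ?_⟩
      rintro rfl
      exact hne (hanti x hx y hy hxa hyx)
    · exact (h ⟨hx, hxa, hne⟩).2.2 rfl
  refine ⟨k, fun a ha b hb hab => ?_, hlt⟩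
  by_contra hne
  rcases htotal a ha b hb with h | h
  · exact (hlt b hb a ha h hne).ne hab
  · exact (hlt a ha b hb h (Ne.symm hne)).ne' hab

/-- For every heavy arc signature `(σ,≪)` of a digraph there exists a `(σ,≪)`-weighting. -/
theorem exists_heavy_weighting {V : Type*} [Fintype V] (A : Set (V × V))
    (σ : V × V → ℝ) (hσ : ∀ a ∈ A, σ a = 1 ∨ σ a = -1)
    (r : V × V → V × V → Prop) (hr : IsLinearOrderOn A r) :
    ∃ w : V × V → ℝ, IsHeavyWeighting A σ r w := by
  classical
  obtain ⟨x, hx⟩ := exists_algebraicIndependent_real (V × V)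
  obtain ⟨k, hkinj, hklt⟩ := hr.exists_injOn_nat A.toFinite
  have hscale (a : V × V) : ∃ q : ℚ, q ≠ 0 ∧ (a ∈ A →
      |q • x a| ∈ Set.Ioo ((3 : ℝ) ^ 2 ^ k a) (3 ^ 2 ^ k a + 1) ∧ Real.sign (q • x a) = σ a) := by
    by_cases ha : a ∈ A
    · obtain ⟨q, hq, h⟩ := exists_rat_smul_abs_mem_Ioo_sign_eq (hx.ne_zero a) (hσ a ha)
        (by positivity : (0 : ℝ) ≤ 3 ^ 2 ^ k a)
      exact ⟨q, hq, fun _ => h⟩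
    · exact ⟨1, one_ne_zero, fun h => absurd h ha⟩
  choose q hq0 hq using hscale
  let w : V × V → ℝ := fun a => q a • x a
  have hw (a : V × V) : w a ∉ Algebra.adjoin ℚ (w '' {a}ᶜ) := hx.smul_notMem_adjoin hq0 a
  refine ⟨w, ⟨fun a _ b _ hab => ?_, fun a _ hmem => hw a ?_⟩, fun a ha => ?_⟩
  · by_contra hne
    exact hw a (Algebra.subset_adjoin ⟨b, Ne.symm hne, hab.symm⟩)
  · refine (Subring.closure_le (t := (Algebra.adjoin ℚ (w '' {a}ᶜ)).toSubring)).2 ?_ hmem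
    rintro _ ⟨⟨b, -, rfl⟩, hb⟩
    exact Algebra.subset_adjoin ⟨b, fun h => hb (congrArg w h), rfl⟩
  obtain ⟨⟨hlow, -⟩, hsign⟩ := hq a ha
  refine ⟨(one_le_pow₀ (by norm_num)).trans hlow.le, hsign, lt_of_le_of_lt ?_ hlow⟩
  let S : Finset (V × V) := {x ∈ A | r x a ∧ x ≠ a}.toFinite.toFinset
  have hS : {x ∈ A | r x a ∧ x ≠ a} = (S : Set (V × V)) := by simp [S]
  have hmem {b : V × V} (hb : b ∈ S) : b ∈ A ∧ r b a ∧ b ≠ a := by simpa [S] using hb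
  rw [hS, finsum_mem_subset_finprod_eq_prod_add_one]
  calc ∏ b ∈ S, (|w b| + 1)
      ≤ ∏ b ∈ S, ((3 : ℝ) ^ 2 ^ k b + 2) := by
        refine Finset.prod_le_prod (fun _ _ => by positivity) fun b hb => ?_
        have : |w b| < 3 ^ 2 ^ k b + 1 := (hq b (hmem hb).1).1.2
        linarith
    _ = ∏ i ∈ S.image k, ((3 : ℝ) ^ 2 ^ i + 2) :=
        (Finset.prod_image (f := fun i => (3 : ℝ) ^ 2 ^ i + 2) fun b hb c hc h => hkinj (hmem hb).1 (hmem hc).1 h).symm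
    _ ≤ ∏ i ∈ Finset.range (k a), ((3 : ℝ) ^ 2 ^ i + 2) := by
        refine Finset.prod_le_prod_of_subset_of_one_le (fun i hi => ?_)
          (fun _ _ => by positivity) fun i _ _ => ?_
        · obtain ⟨b, hb, rfl⟩ := Finset.mem_image.1 hi
          obtain ⟨hbA, hba, hne⟩ := hmem hb
          exact Finset.mem_range.2 (hklt a ha b hbA hba hne)
        · have : (0 : ℝ) ≤ 3 ^ 2 ^ i := by positivity
          linarith
    _ ≤ 3 ^ 2 ^ k a := by linarith [prod_range_three_pow_two_pow_add_two_le (k a)]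
end

section
/- A routing is determined by its set of traversed arcs: if Q and R are routings in a digraph D = (V,A) from the same set X to a set Y such that every path of Q and of R starts in X (i.e., {p₁ : p ∈ Q} = {p₁ : p ∈ R} = X) and Q_A = R_A, where Q_A = ⋃_{p∈Q} |p|_A and R_A = ⋃_{p∈R} |p|_A, then Q = R. -/
theorem isChain_pathArcs {V : Type*} (p : List V) :
    p.IsChain (fun u v => (u, v) ∈ pathArcs p) := by
  induction p with
  | nil => exact .nil
  | cons a l ih =>
    cases l with
    | nil => exact .singleton a
    | cons b l =>
      refine .cons_cons (by simp [pathArcs]) (ih.imp fun u v h => ?_)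
      simp only [pathArcs, List.tail_cons, List.zip_cons_cons, Set.mem_ofPred_eq,
        List.mem_cons] at h ⊢
      exact Or.inr h

theorem fst_mem_of_mem_pathArcs {V : Type*} {p : List V} {u v : V}
    (h : (u, v) ∈ pathArcs p) : u ∈ p :=
  (List.of_mem_zip h).1

theorem eq_of_mem_pathArcs {V : Type*} {p : List V} (hp : p.Nodup) {u v w : V}
    (hv : (u, v) ∈ pathArcs p) (hw : (u, w) ∈ pathArcs p) : v = w := by
  simp only [pathArcs, Set.mem_ofPred_eq, List.mem_iff_getElem, List.getElem_zip,
    List.getElem_tail, Prod.mk.injEq] at hv hw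
  obtain ⟨i, hi, hiu, rfl⟩ := hv
  obtain ⟨j, hj, hju, rfl⟩ := hw
  obtain rfl := hp.getElem_inj_iff.mp (hiu.trans hju.symm)
  rfl

theorem getLast_not_mem_pathArcs {V : Type*} {p : List V} (hp : p.Nodup) {u v : V}
    (hu : p.getLast? = some u) : (u, v) ∉ pathArcs p := by
  intro hv
  simp only [pathArcs, Set.mem_ofPred_eq, List.mem_iff_getElem, List.getElem_zip,
    List.getElem_tail, Prod.mk.injEq] at hv
  obtain ⟨i, hi, hiu, -⟩ := hv
  rw [List.getLast?_eq_getElem?, List.getElem?_eq_some_iff] at hu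
  obtain ⟨hl, hlu⟩ := hu
  have h := hp.getElem_inj_iff.mp (hiu.trans hlu.symm)
  simp only [List.length_zip, List.length_tail] at hi
  omega

/-- Maximal chains of a functional relation are determined by their first element. -/
theorem List.IsChain.eq_of_head?_eq {V : Type*} {r : V → V → Prop}
    (hr : ∀ u v w, r u v → r u w → v = w) {p q : List V}
    (hp : p.IsChain r) (hq : q.IsChain r)
    (hp_last : ∀ y, p.getLast? = some y → ∀ v, ¬ r y v)
    (hq_last : ∀ y, q.getLast? = some y → ∀ v, ¬ r y v)
    (h : p.head? = q.head?) : p = q := by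
  induction p generalizing q with
  | nil => cases q <;> simp_all
  | cons a l ih =>
    cases q with
    | nil => simp at h
    | cons a' m =>
      obtain rfl : a = a' := by simpa using h
      cases l with
      | nil =>
        cases m with
        | nil => rfl
        | cons c m => exact absurd (List.isChain_cons_cons.mp hq).1 (hp_last a rfl c)
      | cons b l =>
        rw [List.isChain_cons_cons] at hp
        cases m with
        | nil => exact absurd hp.1 (hq_last a rfl b)
        | cons c m =>
          rw [List.isChain_cons_cons] at hq
          rw [List.getLast?_cons_cons] at hp_last hq_last
          rw [ih hp.2 hq.2 hp_last hq_last (by simp [hr a b c hp.1 hq.1])]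

theorem pathArcs_subset_routingArcs {V : Type*} {R : Set (List V)} {p : List V} (hp : p ∈ R) :
    pathArcs p ⊆ routingArcs R :=
  Set.subset_biUnion_of_mem (u := pathArcs) hp

theorem IsRouting.mem_pathArcs {V : Type*} {A : Set (V × V)} {R : Set (List V)} {X Y : Set V}
    (hR : IsRouting A R X Y) {p : List V} (hp : p ∈ R) {u v : V} (hu : u ∈ p)
    (h : (u, v) ∈ routingArcs R) : (u, v) ∈ pathArcs p := by
  simp only [routingArcs, Set.mem_iUnion] at h
  obtain ⟨q, hq, h⟩ := h
  obtain rfl | hd := hR.2.2.2 p hp q hq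
  · exact h
  · exact absurd (fst_mem_of_mem_pathArcs h) (hd u hu)

theorem IsRouting.eq_of_mem_routingArcs {V : Type*} {A : Set (V × V)} {R : Set (List V)}
    {X Y : Set V} (hR : IsRouting A R X Y) {u v w : V}
    (hv : (u, v) ∈ routingArcs R) (hw : (u, w) ∈ routingArcs R) : v = w := by
  have hv' := hv
  simp only [routingArcs, Set.mem_iUnion] at hv'
  obtain ⟨p, hp, h⟩ := hv'
  exact eq_of_mem_pathArcs (hR.1 p hp).2 h
    (hR.mem_pathArcs hp (fst_mem_of_mem_pathArcs h) hw)

theorem IsRouting.getLast_not_mem_routingArcs {V : Type*} {A : Set (V × V)} {R : Set (List V)}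
    {X Y : Set V} (hR : IsRouting A R X Y) {p : List V} (hp : p ∈ R) {u v : V}
    (hu : p.getLast? = some u) : (u, v) ∉ routingArcs R := fun h =>
  getLast_not_mem_pathArcs (hR.1 p hp).2 hu
    (hR.mem_pathArcs hp (List.mem_of_getLast? hu) h)

theorem IsRouting.subset_of_routingArcs_eq {V : Type*} {A : Set (V × V)} {Q R : Set (List V)}
    {X Y : Set V} (hQ : IsRouting A Q X Y) (hR : IsRouting A R X Y)
    (hQX : ∀ p ∈ Q, ∃ x ∈ X, p.head? = some x)
    (hQR : routingArcs Q = routingArcs R) : Q ⊆ R := by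
  intro p hp
  obtain ⟨x, hx, hpx⟩ := hQX p hp
  obtain ⟨q, hq, hqx⟩ := hR.2.1 x hx
  have hpq : p = q := List.IsChain.eq_of_head?_eq (r := fun u v => (u, v) ∈ routingArcs R)
    (fun _ _ _ => hR.eq_of_mem_routingArcs)
    ((isChain_pathArcs p).imp fun _ _ h => hQR ▸ pathArcs_subset_routingArcs hp h)
    ((isChain_pathArcs q).imp fun _ _ h => pathArcs_subset_routingArcs hq h)
    (fun _ hy _ => hQR ▸ hQ.getLast_not_mem_routingArcs hp hy)
    (fun _ hy _ => hR.getLast_not_mem_routingArcs hq hy) (hpx.trans hqx.symm)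
  exact hpq ▸ hq


/-- A routing all of whose paths start in `X` is uniquely determined by its set of
traversed arcs. -/
theorem routing_determined_by_arcs {V : Type*} [Fintype V] (A : Set (V × V)) (X Y : Set V)
    (Q R : Set (List V))
    (hQ : IsRouting A Q X Y) (hR : IsRouting A R X Y)
    (hQX : ∀ p ∈ Q, ∃ x ∈ X, p.head? = some x)
    (hRX : ∀ p ∈ R, ∃ x ∈ X, p.head? = some x)
    (hQR : routingArcs Q = routingArcs R) : Q = R := by
  exact (hQ.subset_of_routingArcs_eq hR hQX hQR).antisymm
    (hR.subset_of_routingArcs_eq hQ hRX hQR.symm)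
end

section
/- Let D = (V,A) be a digraph, (σ,≪) a heavy arc signature of D, T, E ⊆ V, and C a circuit of the gammoid Γ(D,T,E). For c, d ∈ C let R_c: C\{c} ⇉ T and R_d: C\{d} ⇉ T be the ≪≪-maximal routings in D (with respect to the (σ,≪)-induced routing order ≪≪). Then {p_{-1} : p ∈ R_c} = {p_{-1} : p ∈ R_d}, i.e., the two maximal routings end in the same set of target vertices. -/
section Walks

variable {V : Type*} {A : Set (V × V)} {U S : Set V}

theorem mem_pathArcs_append_cons {l₁ l₂ : List V} {c : V} {a : V × V} :
    a ∈ pathArcs (l₁ ++ c :: l₂) ↔ a ∈ pathArcs (l₁ ++ [c]) ∨ a ∈ pathArcs (c :: l₂) := by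
  induction l₁ with
  | nil => simp [pathArcs]
  | cons x l ih => cases l <;> simp_all [pathArcs, or_assoc]

theorem fst_mem_of_mem_pathArcs_concat {l : List V} {c : V} {a : V × V}
    (h : a ∈ pathArcs (l ++ [c])) : a.1 ∈ l := by
  induction l with
  | nil => simp [pathArcs] at h
  | cons x l ih =>
    cases l with
    | nil => simp_all [pathArcs]
    | cons y l =>
      simp only [pathArcs, List.cons_append, List.tail_cons, List.zip_cons_cons,
        List.mem_cons, Set.mem_ofPred_eq] at h ih ⊢
      rcases h with rfl | h
      · simp
      · exact Or.inr (ih h)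

theorem fst_mem_of_mem_pathArcs_s9 {l : List V} {a : V × V} (h : a ∈ pathArcs l) : a.1 ∈ l :=
  (List.of_mem_zip (a := a.1) (b := a.2) h).1

theorem pathArcs_subset {p : List V} (hp : p.IsChain fun u v => (u, v) ∈ A) :
    pathArcs p ⊆ A := by
  induction p with
  | nil => simp [pathArcs]
  | cons x l ih =>
    cases l with
    | nil => simp [pathArcs]
    | cons y l =>
      rw [List.isChain_cons_cons] at hp
      intro a ha
      simp only [pathArcs, List.tail_cons, List.zip_cons_cons,
        List.mem_cons, Set.mem_ofPred_eq] at ha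
      rcases ha with rfl | ha
      · exact hp.1
      · exact ih hp.2 ha

/-- A walk visiting `U` and ending outside `U` meets every set `S` containing the out-boundary
of `U`. -/
theorem exists_mem_boundary (hUS : ∀ u v, (u, v) ∈ A → u ∈ U → v ∈ U ∨ v ∈ S) {l : List V}
    (hl : l.IsChain fun u v => (u, v) ∈ A) {v y : V} (hv : v ∈ l) (hvU : v ∈ U)
    (hy : l.getLast? = some y) (hyU : y ∉ U) : ∃ s ∈ l, s ∈ S := by
  induction l generalizing v with
  | nil => simp at hv
  | cons x l ih =>
    cases l with
    | nil => simp_all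
    | cons z l =>
      rw [List.isChain_cons_cons] at hl
      rw [List.getLast?_cons_cons] at hy
      rcases List.mem_cons.1 hv with rfl | hv
      · rcases hUS _ _ hl.1 hvU with h | h
        · obtain ⟨s, hs, hsS⟩ := ih hl.2 (v := z) (by simp) h hy
          exact ⟨s, List.mem_cons_of_mem _ hs, hsS⟩
        · exact ⟨z, by simp, h⟩
      · obtain ⟨s, hs, hsS⟩ := ih hl.2 hv hvU hy
        exact ⟨s, List.mem_cons_of_mem _ hs, hsS⟩

/-- A walk starting in `U ∪ S` and avoiding the set `S`, which contains the out-boundary of `U`,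
stays in `U`. -/
theorem forall_mem_of_avoids_boundary (hUS : ∀ u v, (u, v) ∈ A → u ∈ U → v ∈ U ∨ v ∈ S)
    {l : List V} (hl : l.IsChain fun u v => (u, v) ∈ A)
    (hx : ∀ x, l.head? = some x → x ∈ U ∨ x ∈ S) (hS : ∀ v ∈ l, v ∉ S) : ∀ v ∈ l, v ∈ U := by
  induction l with
  | nil => simp
  | cons x l ih =>
    have hxU : x ∈ U := (hx x rfl).resolve_right (hS x (by simp))
    intro v hv
    rcases List.mem_cons.1 hv with rfl | hv
    · exact hxU
    · refine ih (List.isChain_of_isChain_cons hl) ?_ (fun v hv => hS v (by simp [hv])) v hv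
      intro y hy
      cases l with
      | nil => simp at hy
      | cons z l =>
        obtain rfl : z = y := by simpa using hy
        exact hUS _ _ (List.isChain_cons_cons.1 hl).1 hxU

end Walks

section Splitting

variable {V : Type*} {A : Set (V × V)} {U S T X : Set V}

/-- The list `p₁ ++ s :: p₂` runs inside `U`, then meets `S` in `s` only, and then avoids
`U ∪ S`. -/
def IsSplit (U S : Set V) (p₁ : List V) (s : V) (p₂ : List V) : Prop :=
  s ∈ S ∧ (∀ v ∈ p₁, v ∈ U) ∧ ∀ v ∈ p₂, v ∉ U ∧ v ∉ S

theorem IsSplit.unique (hdisj : ∀ s ∈ S, s ∉ U) {p₁ p₂ q₁ q₂ : List V} {s t : V}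
    (hp : IsSplit U S p₁ s p₂) (hq : IsSplit U S q₁ t q₂)
    (h : p₁ ++ s :: p₂ = q₁ ++ t :: q₂) : p₁ = q₁ ∧ s = t ∧ p₂ = q₂ := by
  induction p₁ generalizing q₁ with
  | nil =>
    cases q₁ with
    | nil => simpa using h
    | cons y l =>
      simp only [List.nil_append, List.cons_append, List.cons.injEq] at h
      exact absurd (hq.2.1 y (by simp)) (h.1 ▸ hdisj s hp.1)
  | cons x k ih =>
    cases q₁ with
    | nil =>
      simp only [List.nil_append, List.cons_append, List.cons.injEq] at h
      exact absurd (hp.2.1 x (by simp)) (h.1 ▸ hdisj t hq.1)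
    | cons y l =>
      simp only [List.cons_append, List.cons.injEq] at h
      obtain ⟨rfl, h⟩ := h
      have := ih ⟨hp.1, fun v hv => hp.2.1 v (by simp [hv]), hp.2.2⟩
        ⟨hq.1, fun v hv => hq.2.1 v (by simp [hv]), hq.2.2⟩ h
      simp [this]

/-- Every path of `R` either avoids `U ∪ S` or splits at a vertex of `S`, and `R` covers `S`. -/
def SplitsAt (U S : Set V) (R : Set (List V)) : Prop :=
  (∀ p ∈ R, (∀ v ∈ p, v ∉ U ∧ v ∉ S) ∨
    ∃ p₁ s p₂, p = p₁ ++ s :: p₂ ∧ IsSplit U S p₁ s p₂) ∧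
  ∀ s ∈ S, ∃ p ∈ R, s ∈ p

theorem SplitsAt.exists_split (hdisj : ∀ s ∈ S, s ∉ U) {R : Set (List V)} (hR : SplitsAt U S R)
    {s : V} (hs : s ∈ S) : ∃ p₁ p₂, p₁ ++ s :: p₂ ∈ R ∧ IsSplit U S p₁ s p₂ := by
  obtain ⟨p, hp, hsp⟩ := hR.2 s hs
  rcases hR.1 p hp with h | ⟨p₁, t, p₂, rfl, h⟩
  · exact absurd hs (h s hsp).2
  · obtain rfl : s = t := by
      rcases List.mem_append.1 hsp with h' | h'
      · exact absurd (h.2.1 s h') (hdisj s hs)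
      · rcases List.mem_cons.1 h' with h' | h'
        · exact h'
        · exact absurd hs (h.2.2 s h').2
    exact ⟨p₁, p₂, hp, h⟩

theorem IsRouting.eq_of_mem {R : Set (List V)} (hR : IsRouting A R X T) {p q : List V}
    (hp : p ∈ R) (hq : q ∈ R) {v : V} (hvp : v ∈ p) (hvq : v ∈ q) : p = q :=
  (hR.2.2.2 p hp q hq).resolve_right fun h => h v hvp hvq

theorem IsRouting.isChain {R : Set (List V)} (hR : IsRouting A R X T) {p : List V} (hp : p ∈ R) :
    p.IsChain fun u v => (u, v) ∈ A :=
  (hR.1 p hp).1.2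

theorem IsRouting.routingArcs_subset {R : Set (List V)} (hR : IsRouting A R X T) :
    routingArcs R ⊆ A :=
  Set.iUnion₂_subset fun _ hp => pathArcs_subset (hR.isChain hp)

/-- A routing from inside `U ∪ S` to targets outside `U` sends distinct sources through distinct
vertices of `S`. -/
theorem IsRouting.exists_injOn_boundary (hUS : ∀ u v, (u, v) ∈ A → u ∈ U → v ∈ U ∨ v ∈ S)
    (hTU : ∀ t ∈ T, t ∉ U) (hX : ∀ x ∈ X, x ∈ U ∨ x ∈ S) {R : Set (List V)}
    (hR : IsRouting A R X T) :
    ∃ φ : V → V, Set.InjOn φ X ∧ (∀ x ∈ X, φ x ∈ S) ∧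
      ∀ x ∈ X, ∃ p ∈ R, p.head? = some x ∧ φ x ∈ p := by
  have key : ∀ x, ∃ s, x ∈ X → s ∈ S ∧ ∃ p ∈ R, p.head? = some x ∧ s ∈ p := by
    intro x
    by_cases hx : x ∈ X
    · obtain ⟨p, hp, hpx⟩ := hR.2.1 x hx
      have hxp : x ∈ p := List.mem_of_head? hpx
      rcases hX x hx with h | h
      · obtain ⟨y, hy, hpy⟩ := hR.2.2.1 p hp
        obtain ⟨s, hsp, hs⟩ := exists_mem_boundary hUS (hR.isChain hp) hxp h hpy (hTU y hy)
        exact ⟨s, fun _ => ⟨hs, p, hp, hpx, hsp⟩⟩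
      · exact ⟨x, fun _ => ⟨h, p, hp, hpx, hxp⟩⟩
    · exact ⟨x, fun h => absurd h hx⟩
  choose φ hφ using key
  refine ⟨φ, fun x hx y hy hxy => ?_, fun x hx => (hφ x hx).1, fun x hx => (hφ x hx).2⟩
  obtain ⟨p, hp, hpx, hsp⟩ := (hφ x hx).2
  obtain ⟨q, hq, hqy, hsq⟩ := (hφ y hy).2
  rw [← hxy] at hsq
  rw [hR.eq_of_mem hp hq hsp hsq, hqy] at hpx
  simpa using hpx.symm

/-- A routing from inside `U ∪ S` to targets outside `U` which has at least as many sources as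
there are vertices in `S` splits at `S`. -/
theorem IsRouting.splitsAt [Finite V] (hUS : ∀ u v, (u, v) ∈ A → u ∈ U → v ∈ U ∨ v ∈ S)
    (hTU : ∀ t ∈ T, t ∉ U) (hX : ∀ x ∈ X, x ∈ U ∨ x ∈ S)
    (hcard : S.ncard ≤ X.ncard) {R : Set (List V)} (hR : IsRouting A R X T) :
    SplitsAt U S R := by
  obtain ⟨φ, hinj, hmaps, hφ⟩ := hR.exists_injOn_boundary hUS hTU hX
  have hsurj : ∀ s ∈ S, ∃ x ∈ X, φ x = s := by
    intro s hs
    obtain ⟨x, hx, h⟩ := Set.surj_on_of_inj_on_of_ncard_le (fun x _ => φ x) hmaps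
      (fun a b ha hb => hinj ha hb) hcard (Set.toFinite _) s hs
    exact ⟨x, hx, h.symm⟩
  have hhead : ∀ p ∈ R, ∀ s ∈ p, s ∈ S → ∃ x ∈ X, φ x = s ∧ p.head? = some x := by
    intro p hp s hsp hs
    obtain ⟨x, hx, rfl⟩ := hsurj s hs
    obtain ⟨q, hq, hqx, hsq⟩ := hφ x hx
    exact ⟨x, hx, rfl, hR.eq_of_mem hp hq hsp hsq ▸ hqx⟩
  have honce : ∀ p ∈ R, ∀ s ∈ p, ∀ t ∈ p, s ∈ S → t ∈ S → s = t := by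
    intro p hp s hsp t htp hs ht
    obtain ⟨x, -, rfl, hpx⟩ := hhead p hp s hsp hs
    obtain ⟨y, -, rfl, hpy⟩ := hhead p hp t htp ht
    rw [hpx] at hpy
    rw [Option.some.inj hpy]
  refine ⟨fun p hp => ?_, fun s hs => ?_⟩
  · obtain ⟨y, hy, hpy⟩ := hR.2.2.1 p hp
    by_cases hpS : ∃ s ∈ p, s ∈ S
    · right
      obtain ⟨s, hsp, hs⟩ := hpS
      obtain ⟨x, hx, -, hpx⟩ := hhead p hp s hsp hs
      obtain ⟨p₁, p₂, rfl⟩ := List.append_of_mem hsp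
      have hnd := (hR.1 _ hp).2
      have hchain := hR.isChain hp
      rw [List.nodup_append] at hnd
      rw [List.isChain_append] at hchain
      have h₁ : ∀ v ∈ p₁, v ∉ S := fun v hv hvS =>
        hnd.2.2 v hv s (by simp) (honce _ hp v (by simp [hv]) s hsp hvS hs)
      have h₂ : ∀ v ∈ p₂, v ∉ S := fun v hv hvS =>
        (List.nodup_cons.1 hnd.2.1).1 (honce _ hp v (by simp [hv]) s hsp hvS hs ▸ hv)
      refine ⟨p₁, s, p₂, rfl, hs, ?_, fun v hv => ⟨fun hvU => ?_, h₂ v hv⟩⟩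
      · refine forall_mem_of_avoids_boundary hUS hchain.1 (fun z hz => ?_) h₁
        rw [List.head?_append, hz] at hpx
        exact Option.some.inj hpx ▸ hX x hx
      · have hlast : p₂.getLast? = some y := by
          cases p₂ with
          | nil => simp at hv
          | cons a l => simpa [List.getLast?_append] using hpy
        obtain ⟨t, ht, htS⟩ := exists_mem_boundary hUS
          (List.isChain_of_isChain_cons hchain.2.1) hv hvU hlast (hTU y hy)
        exact h₂ t ht htS
    · left
      exact fun v hv => ⟨fun hvU => hpS <|
        exists_mem_boundary hUS (hR.isChain hp) hv hvU hpy (hTU y hy), fun hvS => hpS ⟨v, hv, hvS⟩⟩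
  · obtain ⟨x, hx, rfl⟩ := hsurj s hs
    obtain ⟨q, hq, -, hsq⟩ := hφ x hx
    exact ⟨q, hq, hsq⟩

end Splitting

section Splicing

variable {V : Type*} {A : Set (V × V)} {U S T X Y : Set V} {P Q : Set (List V)}

/-- The paths that follow `P` inside `U` until they reach `S` and then continue along `Q`,
together with the paths of `Q` avoiding `U ∪ S`. -/
def spliceRouting (U S : Set V) (P Q : Set (List V)) : Set (List V) :=
  {l | (∃ p₁ s p₂ q₁ q₂, p₁ ++ s :: p₂ ∈ P ∧ IsSplit U S p₁ s p₂ ∧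
      q₁ ++ s :: q₂ ∈ Q ∧ IsSplit U S q₁ s q₂ ∧ l = p₁ ++ s :: q₂) ∨
    (l ∈ Q ∧ ∀ v ∈ l, v ∉ U ∧ v ∉ S)}

theorem IsRouting.splice (hdisj : ∀ s ∈ S, s ∉ U) (hX : ∀ x ∈ X, x ∈ U ∨ x ∈ S)
    (hP : IsRouting A P X T) (hQ : IsRouting A Q Y T)
    (hPS : SplitsAt U S P) (hQS : SplitsAt U S Q) :
    IsRouting A (spliceRouting U S P Q) X T := by
  refine ⟨?_, ?_, ?_, ?_⟩
  · rintro l (⟨p₁, s, p₂, q₁, q₂, hp, hps, hq, hqs, rfl⟩ | ⟨hl, -⟩)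
    · have hpc := List.isChain_split.1 (hP.isChain hp)
      have hqc := List.isChain_split.1 (hQ.isChain hq)
      have hpn := List.nodup_append.1 (hP.1 _ hp).2
      have hqn := List.nodup_append.1 (hQ.1 _ hq).2
      refine ⟨⟨by simp, List.isChain_split.2 ⟨hpc.1, hqc.2⟩⟩,
        List.nodup_append.2 ⟨hpn.1, hqn.2.1, ?_⟩⟩
      rintro v hv w hw rfl
      rcases List.mem_cons.1 hw with rfl | hw
      · exact hdisj v hps.1 (hps.2.1 v hv)
      · exact (hqs.2.2 v hw).1 (hps.2.1 v hv)
    · exact hQ.1 l hl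
  · intro x hx
    obtain ⟨p, hp, hpx⟩ := hP.2.1 x hx
    rcases hPS.1 p hp with h | ⟨p₁, s, p₂, rfl, hps⟩
    · have := h x (List.mem_of_head? hpx)
      exact absurd (hX x hx) (by tauto)
    · obtain ⟨q₁, q₂, hq, hqs⟩ := hQS.exists_split hdisj hps.1
      refine ⟨_, Or.inl ⟨p₁, s, p₂, q₁, q₂, hp, hps, hq, hqs, rfl⟩, ?_⟩
      simpa [List.head?_append] using hpx
  · rintro l (⟨p₁, s, p₂, q₁, q₂, hp, hps, hq, hqs, rfl⟩ | ⟨hl, -⟩)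
    · obtain ⟨y, hy, h⟩ := hQ.2.2.1 _ hq
      exact ⟨y, hy, by simpa [List.getLast?_append] using h⟩
    · exact hQ.2.2.1 l hl
  · have hmixed : ∀ p₁ s q₁ q₂ l, q₁ ++ s :: q₂ ∈ Q → IsSplit U S q₁ s q₂ →
        (∀ v ∈ p₁, v ∈ U) → l ∈ Q → (∀ v ∈ l, v ∉ U ∧ v ∉ S) →
        ∀ v, v ∈ p₁ ++ s :: q₂ → v ∉ l := by
      intro p₁ s q₁ q₂ l hq hqs hp₁ hl hlv v hv hvl
      rcases List.mem_append.1 hv with hv | hv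
      · exact (hlv v hvl).1 (hp₁ v hv)
      · have := hQ.eq_of_mem hq hl (v := v) (List.mem_append.2 (Or.inr hv)) hvl
        exact (hlv s (this ▸ by simp)).2 hqs.1
    rintro l (⟨p₁, s, p₂, q₁, q₂, hp, hps, hq, hqs, rfl⟩ | ⟨hl, hlv⟩)
      l' (⟨p₁', s', p₂', q₁', q₂', hp', hps', hq', hqs', rfl⟩ | ⟨hl', hlv'⟩)
    · by_cases hs : s = s'
      · subst hs
        have h₁ := hps.unique hdisj hps' (hP.eq_of_mem hp hp' (v := s) (by simp) (by simp))
        have h₂ := hqs.unique hdisj hqs' (hQ.eq_of_mem hq hq' (v := s) (by simp) (by simp))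
        exact Or.inl (by rw [h₁.1, h₂.2.2])
      · right
        intro v hv hv'
        have h₁ : ∀ v ∈ p₁, v ∉ p₁' := fun v hv hv' => hs (hps.unique hdisj hps'
          (hP.eq_of_mem hp hp' (v := v) (by simp [hv]) (by simp [hv']))).2.1
        have h₂ : ∀ v ∈ q₂, v ∉ q₂' := fun v hv hv' => hs (hqs.unique hdisj hqs'
          (hQ.eq_of_mem hq hq' (v := v) (by simp [hv]) (by simp [hv']))).2.1
        rw [List.mem_append, List.mem_cons] at hv hv'
        rcases hv with hv | rfl | hv <;> rcases hv' with hv' | rfl | hv'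
        · exact h₁ v hv hv'
        · exact hdisj v hps'.1 (hps.2.1 v hv)
        · exact (hqs'.2.2 v hv').1 (hps.2.1 v hv)
        · exact hdisj v hps.1 (hps'.2.1 v hv')
        · exact hs rfl
        · exact (hqs'.2.2 v hv').2 hps.1
        · exact (hqs.2.2 v hv).1 (hps'.2.1 v hv')
        · exact (hqs.2.2 v hv).2 hps'.1
        · exact h₂ v hv hv'
    · exact Or.inr (hmixed p₁ s q₁ q₂ l' hq hqs hps.2.1 hl' hlv')
    · exact Or.inr fun v hv hv' => hmixed p₁' s' q₁' q₂' l hq' hqs' hps'.2.1 hl hlv v hv' hv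
    · exact hQ.2.2.2 l hl l' hl'

theorem mem_routingArcs_splice (hdisj : ∀ s ∈ S, s ∉ U) (hPS : SplitsAt U S P)
    (hQS : SplitsAt U S Q) {a : V × V} :
    a ∈ routingArcs (spliceRouting U S P Q) ↔
      (a.1 ∈ U ∧ a ∈ routingArcs P) ∨ (a.1 ∉ U ∧ a ∈ routingArcs Q) := by
  have htail : ∀ {p₁ s p₂}, IsSplit U S p₁ s p₂ → a ∈ pathArcs (s :: p₂) → a.1 ∉ U := by
    intro p₁ s p₂ h ha
    rcases List.mem_cons.1 (fst_mem_of_mem_pathArcs_s9 ha) with h' | h'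
    · exact h' ▸ hdisj s h.1
    · exact (h.2.2 _ h').1
  simp only [routingArcs, Set.mem_iUnion, exists_prop]
  constructor
  · rintro ⟨l, ⟨p₁, s, p₂, q₁, q₂, hp, hps, hq, hqs, rfl⟩ | ⟨hl, hlv⟩, ha⟩
    · rcases mem_pathArcs_append_cons.1 ha with ha | ha
      · exact Or.inl ⟨hps.2.1 _ (fst_mem_of_mem_pathArcs_concat ha), _, hp,
          mem_pathArcs_append_cons.2 (Or.inl ha)⟩
      · exact Or.inr ⟨htail hqs ha, _, hq, mem_pathArcs_append_cons.2 (Or.inr ha)⟩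
    · exact Or.inr ⟨(hlv _ (fst_mem_of_mem_pathArcs_s9 ha)).1, l, hl, ha⟩
  · rintro (⟨haU, p, hp, ha⟩ | ⟨haU, q, hq, ha⟩)
    · rcases hPS.1 p hp with h | ⟨p₁, s, p₂, rfl, hps⟩
      · exact absurd haU (h _ (fst_mem_of_mem_pathArcs_s9 ha)).1
      · obtain ⟨q₁, q₂, hq, hqs⟩ := hQS.exists_split hdisj hps.1
        refine ⟨_, Or.inl ⟨p₁, s, p₂, q₁, q₂, hp, hps, hq, hqs, rfl⟩,
          mem_pathArcs_append_cons.2 (Or.inl ?_)⟩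
        exact (mem_pathArcs_append_cons.1 ha).resolve_right fun h => htail hps h haU
    · rcases hQS.1 q hq with h | ⟨q₁, s, q₂, rfl, hqs⟩
      · exact ⟨q, Or.inr ⟨hq, h⟩, ha⟩
      · obtain ⟨p₁, p₂, hp, hps⟩ := hPS.exists_split hdisj hqs.1
        refine ⟨_, Or.inl ⟨p₁, s, p₂, q₁, q₂, hp, hps, hq, hqs, rfl⟩,
          mem_pathArcs_append_cons.2 (Or.inr ?_)⟩
        exact (mem_pathArcs_append_cons.1 ha).resolve_left fun h =>
          haU (hqs.2.1 _ (fst_mem_of_mem_pathArcs_concat h))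

theorem ends_spliceRouting (hdisj : ∀ s ∈ S, s ∉ U) (hPS : SplitsAt U S P)
    (hQS : SplitsAt U S Q) :
    {y | ∃ p ∈ spliceRouting U S P Q, p.getLast? = some y} =
      {y | ∃ p ∈ Q, p.getLast? = some y} := by
  ext y
  constructor
  · rintro ⟨l, ⟨p₁, s, p₂, q₁, q₂, hp, hps, hq, hqs, rfl⟩ | ⟨hl, -⟩, hy⟩
    · exact ⟨_, hq, by simpa [List.getLast?_append] using hy⟩
    · exact ⟨l, hl, hy⟩
  · rintro ⟨q, hq, hy⟩
    rcases hQS.1 q hq with h | ⟨q₁, s, q₂, rfl, hqs⟩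
    · exact ⟨q, Or.inr ⟨hq, h⟩, hy⟩
    · obtain ⟨p₁, p₂, hp, hps⟩ := hPS.exists_split hdisj hqs.1
      exact ⟨_, Or.inl ⟨p₁, s, p₂, q₁, q₂, hp, hps, hq, hqs, rfl⟩,
        by simpa [List.getLast?_append] using hy⟩

/-- Splicing two maximal routings with each other in both ways cannot decrease both of them. -/
theorem splice_eq_or_splice_eq {r : V × V → V × V → Prop} (hr : IsLinearOrderOn A r)
    (hdisj : ∀ s ∈ S, s ∉ U) (hX : ∀ x ∈ X, x ∈ U ∨ x ∈ S) (hY : ∀ y ∈ Y, y ∈ U ∨ y ∈ S)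
    (hP : IsMaxRouting r A P X T) (hQ : IsMaxRouting r A Q Y T)
    (hPS : SplitsAt U S P) (hQS : SplitsAt U S Q) :
    spliceRouting U S P Q = P ∨ spliceRouting U S Q P = Q := by
  by_contra! hne
  obtain ⟨a, haP, ha, hamax⟩ := hP.2 _ (hP.1.splice hdisj hX hQ.1 hPS hQS) hne.1
  obtain ⟨b, hbQ, hb, hbmax⟩ := hQ.2 _ (hQ.1.splice hdisj hY hP.1 hQS hPS) hne.2
  simp only [Set.mem_symmDiff, mem_routingArcs_splice hdisj hPS hQS,
    mem_routingArcs_splice hdisj hQS hPS] at ha hb hamax hbmax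
  have hba := hamax b (by tauto)
  have hab := hbmax a (by tauto)
  obtain rfl := hr.2.1 a (hP.1.routingArcs_subset haP) b (hQ.1.routingArcs_subset hbQ) hab hba
  tauto

end Splicing

section Hall

variable {V : Type*} {A : Set (V × V)} {T C : Set V}

/-- An injective choice of successors outside `C`, made for all vertices outside `T`, can be
followed from the vertices of `C` without ever colliding. -/
theorem eq_of_iterate_eq {g : V → V} (hinj : Set.InjOn g Tᶜ) (hgC : ∀ v ∉ T, g v ∉ C)
    {i j : ℕ} {x y : V} (hx : x ∈ C) (hy : y ∈ C) (hxT : ∀ k < i, g^[k] x ∉ T)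
    (hyT : ∀ k < j, g^[k] y ∉ T) (h : g^[i] x = g^[j] y) : x = y ∧ i = j := by
  induction i generalizing j with
  | zero =>
    cases j with
    | zero => exact ⟨h, rfl⟩
    | succ j =>
      rw [Function.iterate_succ_apply'] at h
      exact absurd (show g (g^[j] y) ∈ C from h ▸ hx) (hgC _ (hyT j j.lt_succ_self))
  | succ i ih =>
    cases j with
    | zero =>
      rw [Function.iterate_succ_apply'] at h
      exact absurd (show g (g^[i] x) ∈ C from h ▸ hy) (hgC _ (hxT i i.lt_succ_self))
    | succ j =>
      rw [Function.iterate_succ_apply', Function.iterate_succ_apply'] at h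
      have := ih (fun k hk => hxT k (by omega)) (fun k hk => hyT k (by omega))
        (hinj (hxT i i.lt_succ_self) (hyT j j.lt_succ_self) h)
      exact ⟨this.1, by rw [this.2]⟩

theorem hasRouting_of_injOn_s9 [Finite V] {g : V → V} (hinj : Set.InjOn g Tᶜ)
    (hgC : ∀ v ∉ T, g v ∉ C) (hgA : ∀ v ∉ T, g v = v ∨ (v, g v) ∈ A) : HasRouting A C T := by
  classical
  have hreach : ∀ x, ∃ n, x ∈ C → g^[n] x ∈ T ∧ ∀ k < n, g^[k] x ∉ T := by
    intro x
    by_cases hx : x ∈ C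
    · have hex : ∃ n, g^[n] x ∈ T := by
        by_contra! hT
        obtain ⟨i, j, hij, h⟩ := Finite.exists_ne_map_eq_of_infinite fun n => g^[n] x
        exact hij (eq_of_iterate_eq hinj hgC hx hx (fun k _ => hT k) (fun k _ => hT k) h).2
      exact ⟨Nat.find hex, fun _ => ⟨Nat.find_spec hex, fun k hk => Nat.find_min hex hk⟩⟩
    · exact ⟨0, fun h => absurd h hx⟩
  choose n hn using hreach
  let orbit : V → List V := fun x => (List.range (n x + 1)).map fun k => g^[k] x
  have hmem : ∀ {x v}, v ∈ orbit x → ∃ k ≤ n x, g^[k] x = v := by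
    intro x v hv
    obtain ⟨k, hk, rfl⟩ := List.mem_map.1 hv
    exact ⟨k, Nat.lt_succ_iff.1 (List.mem_range.1 hk), rfl⟩
  have huniq : ∀ {x y i j}, x ∈ C → y ∈ C → i ≤ n x → j ≤ n y → g^[i] x = g^[j] y →
      x = y ∧ i = j := fun {x y i j} hx hy hi hj h =>
    eq_of_iterate_eq hinj hgC hx hy (fun k hk => (hn x hx).2 k (by omega))
      (fun k hk => (hn y hy).2 k (by omega)) h
  refine ⟨orbit '' C, ?_, fun x hx => ⟨_, ⟨x, hx, rfl⟩, ?_⟩, ?_, ?_⟩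
  · rintro _ ⟨x, hx, rfl⟩
    refine ⟨⟨by simp [orbit], ?_⟩, ?_⟩
    · change List.IsChain _ _
      rw [List.isChain_map, List.isChain_range_succ]
      intro k hk
      rw [Nat.succ_eq_add_one, Function.iterate_succ_apply']
      refine (hgA _ ((hn x hx).2 k hk)).resolve_left fun h => ?_
      rw [← Function.iterate_succ_apply' g] at h
      have := (huniq hx hx hk hk.le h).2
      omega
    · refine List.Nodup.map_on (fun i hi j hj h => ?_) List.nodup_range
      rw [List.mem_range] at hi hj
      exact (huniq hx hx (by omega) (by omega) h).2
  · simp [orbit, List.range_succ_eq_map]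
  · rintro _ ⟨x, hx, rfl⟩
    exact ⟨_, (hn x hx).1, by simp [orbit, List.range_succ]⟩
  · rintro _ ⟨x, hx, rfl⟩ _ ⟨y, hy, rfl⟩
    rw [or_iff_not_imp_left]
    intro hne v hvx hvy
    obtain ⟨i, hi, rfl⟩ := hmem hvx
    obtain ⟨j, hj, h⟩ := hmem hvy
    exact hne (by rw [(huniq hx hy hi hj h.symm).1])

/-- If `C` cannot be routed to `T`, there is a set `U` disjoint from `T` whose closed
out-neighbourhood contains more vertices of `C` than the out-boundary of `U` has vertices. -/
theorem exists_separator_of_not_hasRouting [Finite V] (h : ¬HasRouting A C T) :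
    ∃ U S : Set V, (∀ s ∈ S, s ∉ U) ∧ (∀ u v, (u, v) ∈ A → u ∈ U → v ∈ U ∨ v ∈ S) ∧
      (∀ t ∈ T, t ∉ U) ∧ S.ncard < (C ∩ (U ∪ S)).ncard := by
  classical
  have := Fintype.ofFinite V
  let N : {v // v ∉ T} → Finset V := fun v =>
    Finset.univ.filter fun w => w ∉ C ∧ (w = v ∨ (v.1, w) ∈ A)
  have hHall : ¬∀ s : Finset {v // v ∉ T}, s.card ≤ (s.biUnion N).card := by
    rw [Finset.all_card_le_biUnion_card_iff_exists_injective]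
    rintro ⟨f, hf, hfN⟩
    simp only [N, Finset.mem_filter, Finset.mem_univ, true_and] at hfN
    refine h (hasRouting_of_injOn_s9 (g := fun v => if hv : v ∉ T then f ⟨v, hv⟩ else v) ?_ ?_ ?_)
    · intro x hx y hy hxy
      rw [Set.mem_compl_iff] at hx hy
      simp only [hx, hy, not_false_eq_true, dif_pos] at hxy
      exact congrArg Subtype.val (hf hxy)
    · intro v hv
      simpa [hv] using (hfN ⟨v, hv⟩).1
    · intro v hv
      simpa [hv] using (hfN ⟨v, hv⟩).2
  push Not at hHall
  obtain ⟨s, hs⟩ := hHall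
  let U : Set V := Subtype.val '' (s : Set {v // v ∉ T})
  let S : Set V := {v | v ∉ U ∧ ∃ u ∈ U, (u, v) ∈ A}
  refine ⟨U, S, fun v hv => hv.1, fun u v huv hu => ?_, ?_, ?_⟩
  · by_cases hv : v ∈ U
    · exact Or.inl hv
    · exact Or.inr ⟨hv, u, hu, huv⟩
  · rintro t ht ⟨u, -, rfl⟩
    exact u.2 ht
  · have hU : U.ncard = s.card := by
      rw [Set.ncard_image_of_injective _ Subtype.val_injective, Set.ncard_coe_finset]
    have hN : ((s.biUnion N : Finset V) : Set V) = (U ∪ S) \ C := by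
      ext w
      simp only [N, Finset.coe_biUnion, Finset.mem_coe, Finset.coe_filter, Finset.mem_univ,
        true_and, Set.mem_iUnion, Set.mem_ofPred_eq, exists_prop, Set.mem_sdiff, Set.mem_union]
      constructor
      · rintro ⟨v, hv, hwC, rfl | hvw⟩
        · exact ⟨Or.inl ⟨v, hv, rfl⟩, hwC⟩
        · by_cases hw : w ∈ U
          · exact ⟨Or.inl hw, hwC⟩
          · exact ⟨Or.inr ⟨hw, v, ⟨v, hv, rfl⟩, hvw⟩, hwC⟩
      · rintro ⟨⟨v, hv, rfl⟩ | ⟨-, u, ⟨v, hv, rfl⟩, huw⟩, hwC⟩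
        · exact ⟨v, hv, hwC, Or.inl rfl⟩
        · exact ⟨v, hv, hwC, Or.inr huw⟩
    have hNcard : (s.biUnion N).card = ((U ∪ S) \ C).ncard := by
      rw [← hN, Set.ncard_coe_finset]
    have hdis : Disjoint U S := Set.disjoint_right.2 fun v hv => hv.1
    have h₁ := Set.ncard_union_eq hdis (Set.toFinite _) (Set.toFinite _)
    have h₂ := Set.ncard_inter_add_ncard_sdiff_eq_ncard (U ∪ S) C (Set.toFinite _)
    rw [Set.inter_comm] at h₂
    omega

/-- A circuit `C` is separated from `T` by fewer than `|C|` vertices. -/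
theorem GammoidCircuit.exists_separator [Finite V] {E : Set V} (hC : GammoidCircuit A T E C) :
    ∃ U S : Set V, (∀ s ∈ S, s ∉ U) ∧ (∀ u v, (u, v) ∈ A → u ∈ U → v ∈ U ∨ v ∈ S) ∧
      (∀ t ∈ T, t ∉ U) ∧ (∀ x ∈ C, x ∈ U ∨ x ∈ S) ∧ S.ncard < C.ncard := by
  obtain ⟨U, S, hdisj, hUS, hTU, hcard⟩ := exists_separator_of_not_hasRouting hC.2.1
  have hCsub : C ⊆ U ∪ S := by
    by_contra hne
    obtain ⟨R, hR⟩ := hC.2.2 (C ∩ (U ∪ S))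
      ⟨Set.inter_subset_left, fun h => hne fun x hx => (h hx).2⟩
    obtain ⟨φ, hinj, hmaps, -⟩ := hR.exists_injOn_boundary hUS hTU fun x hx => hx.2
    have := Set.ncard_le_ncard_of_injOn φ hmaps hinj (Set.toFinite _)
    omega
  rw [Set.inter_eq_left.2 hCsub] at hcard
  exact ⟨U, S, hdisj, hUS, hTU, hCsub, hcard⟩

end Hall


/-- For a circuit `C` of the gammoid `Γ(D,T,E)` and `c, d ∈ C`, the `≪≪`-maximal routings
from `C∖{c}` and from `C∖{d}` to `T` end in the same set of target vertices. -/
theorem max_routings_common_ends {V : Type*} [Fintype V] (A : Set (V × V))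
    (σ : V × V → ℝ) (hσ : ∀ a ∈ A, σ a = 1 ∨ σ a = -1)
    (r : V × V → V × V → Prop) (hr : IsLinearOrderOn A r)
    (T E : Set V) (C : Set V) (hC : GammoidCircuit A T E C)
    (c d : V) (hc : c ∈ C) (hd : d ∈ C)
    (Rc Rd : Set (List V))
    (hRc : IsMaxRouting r A Rc (C \ {c}) T)
    (hRd : IsMaxRouting r A Rd (C \ {d}) T) :
    {y | ∃ p ∈ Rc, p.getLast? = some y} = {y | ∃ p ∈ Rd, p.getLast? = some y} := by
  obtain ⟨U, S, hdisj, hUS, hTU, hCsub, hcard⟩ := hC.exists_separator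
  have hsub : ∀ e, ∀ x ∈ C \ {e}, x ∈ U ∨ x ∈ S := fun e x hx => hCsub x hx.1
  have hcard' : ∀ e ∈ C, S.ncard ≤ (C \ {e}).ncard := fun e he => by
    rw [Set.ncard_sdiff_singleton_of_mem he]
    omega
  have hcS := hRc.1.splitsAt hUS hTU (hsub c) (hcard' c hc)
  have hdS := hRd.1.splitsAt hUS hTU (hsub d) (hcard' d hd)
  rcases splice_eq_or_splice_eq hr hdisj (hsub c) (hsub d) hRc hRd hcS hdS with h | h
  · have := ends_spliceRouting hdisj hcS hdS
    rwa [h] at this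
  · have := ends_spliceRouting hdisj hdS hcS
    rw [h] at this
    exact this.symm
end
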